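/- arXiv:2108.07748 — 12 statements merged into one kernel-verified Lean document; each statement's English description precedes it below -/
import Mathlib

section
/- Let C ⊆ ℝ^n be an ambitropical cone. Then C is a conditionally complete lattice in the induced order (every nonempty subset of C that is bounded above has a least upper bound within C, and every nonempty subset of C that is bounded below has a greatest lower bound within C) if and only if C is closed in the Euclidean topology of ℝ^n. -/
open Set Filter Topology

namespace Ambitropical

variable {n : ℕ}

/-- An additive cone of `ℝ^n`: a set stable by the addition of a real constant
to every coordinate. -/
def AdditiveCone (C : Set (Fin n → ℝ)) : Prop :=
  ∀ x ∈ C, ∀ l : ℝ, (fun i => l + x i) ∈ C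

/-- `z` is the least upper bound, *within* `C`, of the subset `X`. -/
def IsLubWithin (C X : Set (Fin n → ℝ)) (z : Fin n → ℝ) : Prop :=
  z ∈ C ∧ (∀ x ∈ X, x ≤ z) ∧ ∀ w ∈ C, (∀ x ∈ X, x ≤ w) → z ≤ w

/-- `z` is the greatest lower bound, *within* `C`, of the subset `X`. -/
def IsGlbWithin (C X : Set (Fin n → ℝ)) (z : Fin n → ℝ) : Prop :=
  z ∈ C ∧ (∀ x ∈ X, z ≤ x) ∧ ∀ w ∈ C, (∀ x ∈ X, w ≤ x) → w ≤ z

/-- An ambitropical cone: a nonempty additive cone of `ℝ^n` that is a lattice in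
the induced (componentwise) partial order. -/
def IsAmbitropicalCone (C : Set (Fin n → ℝ)) : Prop :=
  C.Nonempty ∧ AdditiveCone C ∧
    ∀ x ∈ C, ∀ y ∈ C, (∃ z, IsLubWithin C {x, y} z) ∧ ∃ z, IsGlbWithin C {x, y} z

/-- A (abstract) Shapley operator: order preserving and commuting with the
addition of a constant. -/
def IsShapley {n p : ℕ} (T : (Fin n → ℝ) → (Fin p → ℝ)) : Prop :=
  Monotone T ∧ ∀ (l : ℝ) (x : Fin n → ℝ), T (fun i => l + x i) = fun i => l + T x i

/-- `E^max`: the set of componentwise suprema of bounded-above families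
`(λ_f + f)_{f ∈ E}` with `λ_f ∈ ℝ ∪ {-∞}`, not all `-∞` (the subfamily with
finite coefficients is encoded by a nonempty subset `S` of `E`). -/
def MaxGen (E : Set (Fin n → ℝ)) : Set (Fin n → ℝ) :=
  {x | ∃ S : Set (Fin n → ℝ), S ⊆ E ∧ S.Nonempty ∧ ∃ lam : (Fin n → ℝ) → ℝ,
      (∃ u : Fin n → ℝ, ∀ f ∈ S, (fun i => lam f + f i) ≤ u) ∧
      ∀ i, IsLUB {v : ℝ | ∃ f ∈ S, v = lam f + f i} (x i)}

/-- `E^min`: the set of componentwise infima of bounded-below families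
`(μ_f + f)_{f ∈ E}` with `μ_f ∈ ℝ ∪ {+∞}`, not all `+∞`. -/
def MinGen (E : Set (Fin n → ℝ)) : Set (Fin n → ℝ) :=
  {x | ∃ S : Set (Fin n → ℝ), S ⊆ E ∧ S.Nonempty ∧ ∃ mu : (Fin n → ℝ) → ℝ,
      (∃ u : Fin n → ℝ, ∀ f ∈ S, u ≤ (fun i => mu f + f i)) ∧
      ∀ i, IsGLB {v : ℝ | ∃ f ∈ S, v = mu f + f i} (x i)}

/-- `P` is the tropical projection `P^max_E`, i.e. `P z = sup {y ∈ E^max ∣ y ≤ z}`. -/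
def IsPmaxMap (E : Set (Fin n → ℝ)) (P : (Fin n → ℝ) → Fin n → ℝ) : Prop :=
  ∀ z, IsLUB {y | y ∈ MaxGen E ∧ y ≤ z} (P z)

/-- `P` is the dual tropical projection `P^min_E`, i.e. `P z = inf {y ∈ E^min ∣ z ≤ y}`. -/
def IsPminMap (E : Set (Fin n → ℝ)) (P : (Fin n → ℝ) → Fin n → ℝ) : Prop :=
  ∀ z, IsGLB {y | y ∈ MinGen E ∧ z ≤ y} (P z)

/-- `Q` is the canonical retraction `Q_C^-`, i.e. `Q x = sup^C {y ∈ C ∣ y ≤ x}`. -/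
def IsQminusMap (C : Set (Fin n → ℝ)) (Q : (Fin n → ℝ) → Fin n → ℝ) : Prop :=
  ∀ x, IsLubWithin C {y ∈ C | y ≤ x} (Q x)

/-- `Q` is the canonical retraction `Q_C^+`, i.e. `Q x = inf^C {y ∈ C ∣ x ≤ y}`. -/
def IsQplusMap (C : Set (Fin n → ℝ)) (Q : (Fin n → ℝ) → Fin n → ℝ) : Prop :=
  ∀ x, IsGlbWithin C {y ∈ C | x ≤ y} (Q x)

/-- A tropical cone: an additive cone stable by componentwise max. -/
def TropicalCone (C : Set (Fin n → ℝ)) : Prop :=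
  AdditiveCone C ∧ ∀ x ∈ C, ∀ y ∈ C, x ⊔ y ∈ C

/-- A dual tropical cone: an additive cone stable by componentwise min. -/
def DualTropicalCone (C : Set (Fin n → ℝ)) : Prop :=
  AdditiveCone C ∧ ∀ x ∈ C, ∀ y ∈ C, x ⊓ y ∈ C

/-- `t(u) = max_i u_i`. -/
noncomputable def tmax (u : Fin n → ℝ) : ℝ := ⨆ i, u i

/-- `b(u) = min_i u_i`. -/
noncomputable def bmin (u : Fin n → ℝ) : ℝ := ⨅ i, u i

/-- An alcoved polyhedron: a set of the form
`{x ∣ x_i ≥ M_ij + x_j}` with `M_ij ∈ ℝ ∪ {-∞}` (constraints with `M_ij = -∞`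
are vacuous, as `⊥ + x_j = ⊥` in `WithBot ℝ`). -/
def IsAlcoved (C : Set (Fin n → ℝ)) : Prop :=
  ∃ M : Fin n → Fin n → WithBot ℝ,
    C = {x | ∀ i j, M i j + (x j : WithBot ℝ) ≤ (x i : WithBot ℝ)}

/-- A homogeneous subset of `ℝ^n`: stable by multiplication by positive scalars. -/
def HomogeneousSet (C : Set (Fin n → ℝ)) : Prop :=
  ∀ α : ℝ, 0 < α → ∀ x ∈ C, α • x ∈ C

/-- A (positively) homogeneous operator. -/
def HomogeneousMap (T : (Fin n → ℝ) → Fin n → ℝ) : Prop :=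
  ∀ α : ℝ, 0 < α → ∀ x : Fin n → ℝ, T (α • x) = α • T x

/-- A finitely generated Shapley operator `T = A^♯ ∘ B` for a proper pair of
matrices `A, B` with entries in `ℝ ∪ {-∞}`:
`T_i(x) = min_{j : A_{ji} ≠ -∞} ( -A_{ji} + max_{k : B_{jk} ≠ -∞} (B_{jk} + x_k) )`. -/
def FgShapley {n : ℕ} (T : (Fin n → ℝ) → Fin n → ℝ) : Prop :=
  ∃ (m : ℕ) (A B : Fin m → Fin n → WithBot ℝ),
    (∀ i : Fin n, ∃ j : Fin m, A j i ≠ ⊥) ∧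
    (∀ j : Fin m, ∃ k : Fin n, B j k ≠ ⊥) ∧
    ∀ (x : Fin n → ℝ) (i : Fin n),
      T x i = sInf {v : ℝ | ∃ (j : Fin m) (a : ℝ), A j i = (a : WithBot ℝ) ∧
        v = -a + sSup {w : ℝ | ∃ (k : Fin n) (b : ℝ), B j k = (b : WithBot ℝ) ∧ w = b + x k}}

/-- An ambitropical cone `C ⊆ ℝ^n` is a conditionally complete
lattice in the induced order (every nonempty subset of `C` bounded above has a
least upper bound within `C`, and dually) iff `C` is closed in the Euclidean
topology. -/
theorem ambitropical_conditionallyComplete_iff_isClosed {n : ℕ}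
    (C : Set (Fin n → ℝ)) (hC : IsAmbitropicalCone C) :
    ((∀ X ⊆ C, X.Nonempty → (∃ b ∈ C, ∀ x ∈ X, x ≤ b) → ∃ z, IsLubWithin C X z) ∧
      (∀ X ⊆ C, X.Nonempty → (∃ b ∈ C, ∀ x ∈ X, b ≤ x) → ∃ z, IsGlbWithin C X z)) ↔
    IsClosed C := by
  obtain ⟨-, hadd, hlat⟩ := hC
  constructor
  · rintro ⟨hsup, -⟩
    refine isClosed_of_closure_subset fun x hx => ?_
    have key : ∀ ε : ℝ, 0 < ε → ∃ y ∈ C, ∀ i, |x i - y i| < ε := by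
      intro ε hε
      obtain ⟨y, hy, hd⟩ := Metric.mem_closure_iff.1 hx ε hε
      refine ⟨y, hy, fun i => ?_⟩
      have := (dist_pi_lt_iff hε).1 hd i
      rwa [Real.dist_eq] at this
    have low : ∀ ε : ℝ, 0 < ε → ∃ y ∈ C, y ≤ x ∧ ∀ i, x i - ε ≤ y i := by
      intro ε hε
      obtain ⟨y, hy, hd⟩ := key (ε / 2) (by positivity)
      refine ⟨_, hadd y hy (-(ε / 2)), fun i => ?_, fun i => ?_⟩ <;>
      · have := abs_lt.1 (hd i)
        try simp only
        linarith
    have upp : ∀ ε : ℝ, 0 < ε → ∃ y ∈ C, x ≤ y ∧ ∀ i, y i ≤ x i + ε := by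
      intro ε hε
      obtain ⟨y, hy, hd⟩ := key (ε / 2) (by positivity)
      refine ⟨_, hadd y hy (ε / 2), fun i => ?_, fun i => ?_⟩ <;>
      · have := abs_lt.1 (hd i)
        try simp only
        linarith
    obtain ⟨z, hz, hz1, hz2⟩ := hsup {y | y ∈ C ∧ y ≤ x} (fun y hy => hy.1)
      (by obtain ⟨y, hy, h, -⟩ := low 1 one_pos; exact ⟨y, hy, h⟩)
      (by obtain ⟨y, hy, h, -⟩ := upp 1 one_pos; exact ⟨y, hy, fun w hw => hw.2.trans h⟩)
    have : z = x := by
      funext i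
      apply le_antisymm
      · refine le_of_forall_pos_le_add fun ε hε => ?_
        obtain ⟨y, hy, h, h'⟩ := upp ε hε
        exact (hz2 y hy (fun w hw => hw.2.trans h) i).trans (h' i)
      · refine le_of_forall_pos_le_add fun ε hε => ?_
        obtain ⟨y, hy, h, h'⟩ := low ε hε
        have h1 := hz1 y ⟨hy, h⟩ i
        have h2 := h' i
        linarith
    exact this ▸ hz
  · intro hcl
    constructor
    · rintro X hX ⟨x0, hx0⟩ ⟨b, hb, hXb⟩
      let D : Set (Fin n → ℝ) := {d | d ∈ C ∧ ∀ w ∈ C, (∀ x ∈ X, x ≤ w) → d ≤ w}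
      have hXD : ∀ x ∈ X, x ∈ D := fun x hx => ⟨hX hx, fun w _ h => h x hx⟩
      have : Nonempty D := ⟨⟨x0, hXD x0 hx0⟩⟩
      have : IsDirectedOrder D := ⟨by
        rintro ⟨d, hd⟩ ⟨e, he⟩
        obtain ⟨z, hz, h1, h2⟩ := (hlat d hd.1 e he.1).1
        refine ⟨⟨z, hz, fun w hw h => h2 w hw ?_⟩, h1 d (by simp), h1 e (by simp)⟩
        rintro y (rfl | rfl)
        · exact hd.2 w hw h
        · exact he.2 w hw h⟩
      have hbdd : ∀ i, BddAbove (range fun d : D => d.1 i) := by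
        intro i
        refine ⟨b i, ?_⟩
        rintro _ ⟨d, rfl⟩
        exact d.2.2 b hb hXb i
      have ht : Tendsto (fun d : D => d.1) atTop (𝓝 fun i => ⨆ d : D, d.1 i) :=
        tendsto_pi_nhds.2 fun i => tendsto_atTop_ciSup (fun d e h => h i) (hbdd i)
      refine ⟨_, hcl.mem_of_tendsto ht (Eventually.of_forall fun d => d.2.1), ?_, ?_⟩
      · intro x hx i
        exact le_ciSup (hbdd i) ⟨x, hXD x hx⟩
      · intro w hw h i
        exact ciSup_le fun d => d.2.2 w hw h i
    · rintro X hX ⟨x0, hx0⟩ ⟨b, hb, hXb⟩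
      let D : Set (Fin n → ℝ) := {d | d ∈ C ∧ ∀ w ∈ C, (∀ x ∈ X, w ≤ x) → w ≤ d}
      have hXD : ∀ x ∈ X, x ∈ D := fun x hx => ⟨hX hx, fun w _ h => h x hx⟩
      have : Nonempty D := ⟨⟨x0, hXD x0 hx0⟩⟩
      have : IsCodirectedOrder D := ⟨by
        rintro ⟨d, hd⟩ ⟨e, he⟩
        obtain ⟨z, hz, h1, h2⟩ := (hlat d hd.1 e he.1).2
        refine ⟨⟨z, hz, fun w hw h => h2 w hw ?_⟩, h1 d (by simp), h1 e (by simp)⟩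
        rintro y (rfl | rfl)
        · exact hd.2 w hw h
        · exact he.2 w hw h⟩
      have hbdd : ∀ i, BddBelow (range fun d : D => d.1 i) := by
        intro i
        refine ⟨b i, ?_⟩
        rintro _ ⟨d, rfl⟩
        exact d.2.2 b hb hXb i
      have ht : Tendsto (fun d : D => d.1) atBot (𝓝 fun i => ⨅ d : D, d.1 i) :=
        tendsto_pi_nhds.2 fun i => tendsto_atBot_ciInf (fun d e h => h i) (hbdd i)
      refine ⟨_, hcl.mem_of_tendsto ht (Eventually.of_forall fun d => d.2.1), ?_, ?_⟩
      · intro x hx i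
        exact ciInf_le (hbdd i) ⟨x, hXD x hx⟩
      · intro w hw h i
        exact le_ciInf fun d => d.2.2 w hw h i


end Ambitropical
end

section
/- Let C ⊆ ℝ^n be a closed ambitropical cone. Then the map Q_C^-(x) = sup^C{y ∈ C : y ≤ x} is a Shapley operator ℝ^n → ℝ^n, it is idempotent (Q_C^- ∘ Q_C^- = Q_C^-), and its range equals C. The same conclusions hold for Q_C^+(x) = inf^C{y ∈ C : y ≥ x}. -/
open Set Filter Topology

namespace Ambitropical

variable {n : ℕ}

theorem exists_least_of_directed {n : ℕ} (U : Set (Fin n → ℝ)) (hcl : IsClosed U)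
    (hne : U.Nonempty) (a : Fin n → ℝ) (ha : ∀ u ∈ U, a ≤ u)
    (hd : ∀ u ∈ U, ∀ v ∈ U, ∃ w ∈ U, w ≤ u ∧ w ≤ v) : ∃ z ∈ U, ∀ w ∈ U, z ≤ w := by
  obtain ⟨u0, hu0⟩ := hne
  have hcomp : IsCompact (Set.Icc a u0 ∩ U) := isCompact_Icc.inter_right hcl
  have hcont : ContinuousOn (fun u : Fin n → ℝ => ∑ i, u i) (Set.Icc a u0 ∩ U) := by
    apply Continuous.continuousOn
    fun_prop
  obtain ⟨z, ⟨hz1, hzU⟩, hmin⟩ := hcomp.exists_isMinOn ⟨u0, ⟨ha u0 hu0, le_refl _⟩, hu0⟩ hcont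
  refine ⟨z, hzU, fun w hw => ?_⟩
  obtain ⟨t, htU, htz, htw⟩ := hd z hzU w hw
  have h1 : ∑ i, z i ≤ ∑ i, t i :=
    isMinOn_iff.mp hmin t ⟨⟨ha t htU, htz.trans hz1.2⟩, htU⟩
  have h2 : ∑ i, t i = ∑ i, z i := le_antisymm (Finset.sum_le_sum fun i _ => htz i) h1
  have h3 := (Finset.sum_eq_sum_iff_of_le (fun i _ => htz i)).mp h2
  intro i
  rw [← h3 i (Finset.mem_univ i)]
  exact htw i

theorem exists_greatest_of_directed {n : ℕ} (U : Set (Fin n → ℝ)) (hcl : IsClosed U)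
    (hne : U.Nonempty) (a : Fin n → ℝ) (ha : ∀ u ∈ U, u ≤ a)
    (hd : ∀ u ∈ U, ∀ v ∈ U, ∃ w ∈ U, u ≤ w ∧ v ≤ w) : ∃ z ∈ U, ∀ w ∈ U, w ≤ z := by
  obtain ⟨z, hz, h⟩ := exists_least_of_directed (Neg.neg ⁻¹' U) (hcl.preimage continuous_neg)
    (by obtain ⟨u, hu⟩ := hne
        exact ⟨-u, by simpa using hu⟩) (-a)
    (fun u hu => neg_le.mp (ha _ hu))
    (fun u hu v hv => by
      obtain ⟨w, hw, h1, h2⟩ := hd _ hu _ hv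
      exact ⟨-w, by simpa using hw, neg_le.mp h1, neg_le.mp h2⟩)
  refine ⟨-z, hz, fun w hw => ?_⟩
  exact le_neg.mp (h (-w) (by simpa using hw))

theorem exists_translate {n : ℕ} (c x : Fin n → ℝ) : ∃ l : ℝ, ∀ i, x i ≤ l + c i := by
  refine ⟨∑ i, |x i - c i|, fun i => ?_⟩
  have h := Finset.single_le_sum (f := fun i => |x i - c i|) (fun i _ => abs_nonneg _)
    (Finset.mem_univ i)
  have h2 := le_abs_self (x i - c i)
  linarith

theorem exists_qminus {n : ℕ} (C : Set (Fin n → ℝ)) (hC : IsAmbitropicalCone C)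
    (hcl : IsClosed C) (x : Fin n → ℝ) : ∃ z, IsLubWithin C {y ∈ C | y ≤ x} z := by
  obtain ⟨⟨c, hc⟩, hadd, hlat⟩ := hC
  obtain ⟨l, hl⟩ := exists_translate c x
  obtain ⟨m, hm⟩ := exists_translate x c
  have hy : (fun i => -m + c i) ∈ {y ∈ C | y ≤ x} :=
    ⟨hadd c hc _, fun i => by have := hm i; simp only; linarith⟩
  obtain ⟨z, hz, h⟩ := exists_least_of_directed (C ∩ upperBounds {y ∈ C | y ≤ x})
    (hcl.inter (by
      simp only [upperBounds, Set.setOf_forall]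
      exact isClosed_iInter fun y => isClosed_iInter fun _ => isClosed_Ici)) ⟨_, hadd c hc l, fun y hy => hy.2.trans hl⟩ _
    (fun u hu => hu.2 hy) (fun u hu v hv => by
      obtain ⟨w, hw, h1, h2⟩ := (hlat u hu.1 v hv.1).2
      refine ⟨w, ⟨hw, fun y hy => h2 y hy.1 ?_⟩, h1 _ (by simp), h1 _ (by simp)⟩
      rintro t (rfl | rfl)
      · exact hu.2 hy
      · exact hv.2 hy)
  exact ⟨z, hz.1, fun y hy => hz.2 hy, fun w hw hw2 => h w ⟨hw, fun y hy => hw2 y hy⟩⟩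

theorem exists_qplus {n : ℕ} (C : Set (Fin n → ℝ)) (hC : IsAmbitropicalCone C)
    (hcl : IsClosed C) (x : Fin n → ℝ) : ∃ z, IsGlbWithin C {y ∈ C | x ≤ y} z := by
  obtain ⟨⟨c, hc⟩, hadd, hlat⟩ := hC
  obtain ⟨l, hl⟩ := exists_translate c x
  obtain ⟨m, hm⟩ := exists_translate x c
  have hy : (fun i => l + c i) ∈ {y ∈ C | x ≤ y} := ⟨hadd c hc _, hl⟩
  have hm' : (fun i => -m + c i) ≤ x := fun i => by have := hm i; simp only; linarith
  obtain ⟨z, hz, h⟩ := exists_greatest_of_directed (C ∩ lowerBounds {y ∈ C | x ≤ y})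
    (hcl.inter (by
      simp only [lowerBounds, Set.setOf_forall]
      exact isClosed_iInter fun y => isClosed_iInter fun _ => isClosed_Iic)) ⟨_, hadd c hc (-m), fun y hy => hm'.trans hy.2⟩ _
    (fun u hu => hu.2 hy) (fun u hu v hv => by
      obtain ⟨w, hw, h1, h2⟩ := (hlat u hu.1 v hv.1).1
      refine ⟨w, ⟨hw, fun y hy => h2 y hy.1 ?_⟩, h1 _ (by simp), h1 _ (by simp)⟩
      rintro t (rfl | rfl)
      · exact hu.2 hy
      · exact hv.2 hy)
  exact ⟨z, hz.1, fun y hy => hz.2 hy, fun w hw hw2 => h w ⟨hw, fun y hy => hw2 y hy⟩⟩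

/-- Let `C ⊆ ℝ^n` be a closed ambitropical cone. Then the map
`Q_C^- : x ↦ sup^C {y ∈ C ∣ y ≤ x}` (which exists) is an idempotent Shapley
operator with range `C`; the same holds for `Q_C^+ : x ↦ inf^C {y ∈ C ∣ y ≥ x}`. -/
theorem canonical_retractions_are_idempotent_shapley {n : ℕ}
    (C : Set (Fin n → ℝ)) (hC : IsAmbitropicalCone C) (hcl : IsClosed C) :
    (∃ Q : (Fin n → ℝ) → Fin n → ℝ,
      IsQminusMap C Q ∧ IsShapley Q ∧ Q ∘ Q = Q ∧ Set.range Q = C) ∧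
    (∃ Q : (Fin n → ℝ) → Fin n → ℝ,
      IsQplusMap C Q ∧ IsShapley Q ∧ Q ∘ Q = Q ∧ Set.range Q = C) := by
  have hadd := hC.2.1
  constructor
  · choose Q hQ using exists_qminus C hC hcl
    have hfix : ∀ c ∈ C, Q c = c := fun c hc =>
      le_antisymm ((hQ c).2.2 c hc fun y hy => hy.2) ((hQ c).2.1 c ⟨hc, le_refl _⟩)
    have hhom : ∀ (l : ℝ) (x : Fin n → ℝ), Q (fun i => l + x i) ≤ fun i => l + Q x i := by
      intro l x
      refine (hQ _).2.2 _ (hadd _ (hQ x).1 l) fun y hy i => ?_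
      have h := (hQ x).2.1 (fun i => -l + y i)
        ⟨hadd y hy.1 _, fun j => by have := hy.2 j; simp only at this ⊢; linarith⟩ i
      simp only at h ⊢
      linarith
    refine ⟨Q, hQ, ⟨fun x x' h => ?_, fun l x => le_antisymm (hhom l x) fun i => ?_⟩,
      funext fun x => hfix _ (hQ x).1, Set.Subset.antisymm ?_ fun c hc => ⟨c, hfix c hc⟩⟩
    · exact (hQ x).2.2 _ (hQ x').1 fun y hy => (hQ x').2.1 y ⟨hy.1, hy.2.trans h⟩
    · have h := hhom (-l) (fun i => l + x i) i
      simp only [neg_add_cancel_left] at h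
      linarith
    · rintro _ ⟨x, rfl⟩
      exact (hQ x).1
  · choose Q hQ using exists_qplus C hC hcl
    have hfix : ∀ c ∈ C, Q c = c := fun c hc =>
      le_antisymm ((hQ c).2.1 c ⟨hc, le_refl _⟩) ((hQ c).2.2 c hc fun y hy => hy.2)
    have hhom : ∀ (l : ℝ) (x : Fin n → ℝ), (fun i => l + Q x i) ≤ Q (fun i => l + x i) := by
      intro l x
      refine (hQ _).2.2 _ (hadd _ (hQ x).1 l) fun y hy i => ?_
      have h := (hQ x).2.1 (fun i => -l + y i)
        ⟨hadd y hy.1 _, fun j => by have := hy.2 j; simp only at this ⊢; linarith⟩ i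
      simp only at h ⊢
      linarith
    refine ⟨Q, hQ, ⟨fun x x' h => ?_, fun l x => le_antisymm (fun i => ?_) (hhom l x)⟩,
      funext fun x => hfix _ (hQ x).1, Set.Subset.antisymm ?_ fun c hc => ⟨c, hfix c hc⟩⟩
    · exact (hQ x').2.2 _ (hQ x).1 fun y hy => (hQ x).2.1 y ⟨hy.1, h.trans hy.2⟩
    · have h := hhom (-l) (fun i => l + x i) i
      simp only [neg_add_cancel_left] at h
      linarith
    · rintro _ ⟨x, rfl⟩
      exact (hQ x).1

end Ambitropical
end

section
/- Let C ⊆ ℝ^n be a closed ambitropical cone. (i) Every Shapley retraction onto C, i.e., every Shapley operator P : ℝ^n → ℝ^n with P ∘ P = P and range P = C, satisfies Q_C^-(x) ≤ P(x) ≤ Q_C^+(x) for all x ∈ ℝ^n. (ii) For every nonempty family (Q_α)_{α∈A} of Shapley retractions onto C, the map Q(x) = sup^C{Q_α(x) : α ∈ A} is again a Shapley retraction onto C, and it is the least upper bound of the family in the pointwise order. Consequently, the set of Shapley retractions onto C is a complete lattice with bottom element Q_C^- and top element Q_C^+. -/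
open Set Filter Topology

namespace Ambitropical

variable {n : ℕ}

/-- A Shapley retraction onto `C`: an idempotent Shapley operator with range `C`. -/
def IsShapleyRetractionOnto {n : ℕ} (C : Set (Fin n → ℝ))
    (P : (Fin n → ℝ) → Fin n → ℝ) : Prop :=
  IsShapley P ∧ P ∘ P = P ∧ Set.range P = C

theorem retraction_of {n : ℕ} {C : Set (Fin n → ℝ)} {Q : (Fin n → ℝ) → Fin n → ℝ}
    (hmono : Monotone Q)
    (hadd : ∀ (l : ℝ) (x : Fin n → ℝ), Q (fun i => l + x i) ≤ fun i => l + Q x i)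
    (hmem : ∀ x, Q x ∈ C) (hfix : ∀ x ∈ C, Q x = x) : IsShapleyRetractionOnto C Q := by
  refine ⟨⟨hmono, fun l x => le_antisymm (hadd l x) fun i => ?_⟩, ?_, ?_⟩
  · have h := hadd (-l) (fun i => l + x i) i
    simp only [neg_add_cancel_left] at h
    show l + Q x i ≤ _
    linarith
  · funext x
    exact hfix _ (hmem x)
  · ext y
    exact ⟨fun ⟨x, hx⟩ => hx ▸ hmem x, fun hy => ⟨y, hfix y hy⟩⟩

theorem retraction_of_opp {n : ℕ} {C : Set (Fin n → ℝ)} {Q : (Fin n → ℝ) → Fin n → ℝ}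
    (hmono : Monotone Q)
    (hadd : ∀ (l : ℝ) (x : Fin n → ℝ), (fun i => l + Q x i) ≤ Q (fun i => l + x i))
    (hmem : ∀ x, Q x ∈ C) (hfix : ∀ x ∈ C, Q x = x) : IsShapleyRetractionOnto C Q := by
  refine retraction_of hmono (fun l x i => ?_) hmem hfix
  have h := hadd (-l) (fun i => l + x i) i
  simp only [neg_add_cancel_left] at h
  show _ ≤ l + Q x i
  linarith

theorem IsShapleyRetractionOnto.mem {n : ℕ} {C : Set (Fin n → ℝ)}
    {P : (Fin n → ℝ) → Fin n → ℝ} (h : IsShapleyRetractionOnto C P) (x : Fin n → ℝ) :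
    P x ∈ C := h.2.2 ▸ Set.mem_range_self x

theorem IsShapleyRetractionOnto.fix {n : ℕ} {C : Set (Fin n → ℝ)}
    {P : (Fin n → ℝ) → Fin n → ℝ} (h : IsShapleyRetractionOnto C P) (x : Fin n → ℝ)
    (hx : x ∈ C) : P x = x := by
  rw [← h.2.2] at hx
  obtain ⟨y, rfl⟩ := hx
  exact congrFun h.2.1 y

/-- Let `C ⊆ ℝ^n` be a closed ambitropical cone, and let
`Qm = Q_C^-`, `Qp = Q_C^+` be the canonical retractions. Then:
(i) every Shapley retraction `P` onto `C` satisfies `Qm x ≤ P x ≤ Qp x`;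
(ii) for every nonempty family `(Q_α)` of Shapley retractions onto `C`, the map
`Q : x ↦ sup^C {Q_α(x)}` is a Shapley retraction onto `C` and is the least
upper bound of the family in the pointwise order; consequently
(iii) `Qm` and `Qp` are themselves Shapley retractions onto `C` (the bottom and
top elements of the complete lattice of Shapley retractions onto `C`). -/
theorem shapley_retractions_complete_lattice {n : ℕ}
    (C : Set (Fin n → ℝ)) (hC : IsAmbitropicalCone C) (hcl : IsClosed C)
    (Qm Qp : (Fin n → ℝ) → Fin n → ℝ)
    (hQm : IsQminusMap C Qm) (hQp : IsQplusMap C Qp) :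
    (∀ P : (Fin n → ℝ) → Fin n → ℝ, IsShapleyRetractionOnto C P →
      ∀ x, Qm x ≤ P x ∧ P x ≤ Qp x) ∧
    (∀ (A : Type) (Qf : A → (Fin n → ℝ) → Fin n → ℝ), Nonempty A →
      (∀ a, IsShapleyRetractionOnto C (Qf a)) →
      ∀ Q : (Fin n → ℝ) → Fin n → ℝ,
        (∀ x, IsLubWithin C {y | ∃ a, y = Qf a x} (Q x)) →
        IsShapleyRetractionOnto C Q ∧
        (∀ a x, Qf a x ≤ Q x) ∧
        (∀ R, IsShapleyRetractionOnto C R → (∀ a x, Qf a x ≤ R x) → ∀ x, Q x ≤ R x)) ∧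
    IsShapleyRetractionOnto C Qm ∧ IsShapleyRetractionOnto C Qp := by
  have hA := hC.2.1
  refine ⟨fun P hP x => ⟨?_, ?_⟩, ?_, ?_, ?_⟩
  · refine (hQm x).2.2 _ (hP.mem x) fun y hy => ?_
    rw [← hP.fix y hy.1]
    exact hP.1.1 hy.2
  · refine (hQp x).2.2 _ (hP.mem x) fun y hy => ?_
    rw [← hP.fix y hy.1]
    exact hP.1.1 hy.2
  · intro A Qf hne hQf Q hQ
    have hub : ∀ a x, Qf a x ≤ Q x := fun a x => (hQ x).2.1 _ ⟨a, rfl⟩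
    refine ⟨retraction_of ?_ ?_ (fun x => (hQ x).1) ?_, hub, ?_⟩
    · intro x y hxy
      refine (hQ x).2.2 _ (hQ y).1 ?_
      rintro _ ⟨a, rfl⟩
      exact ((hQf a).1.1 hxy).trans (hub a y)
    · intro l x
      refine (hQ _).2.2 _ (hA _ (hQ x).1 l) ?_
      rintro _ ⟨a, rfl⟩
      rw [(hQf a).1.2]
      exact fun i => add_le_add_right (hub a x i) l
    · intro x hx
      obtain ⟨a⟩ := hne
      refine le_antisymm ((hQ x).2.2 x hx ?_) ?_
      · rintro _ ⟨b, rfl⟩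
        exact ((hQf b).fix x hx).le
      · exact ((hQf a).fix x hx).symm.le.trans (hub a x)
    · intro R hR hle x
      refine (hQ x).2.2 _ (hR.mem x) ?_
      rintro _ ⟨a, rfl⟩
      exact hle a x
  · refine retraction_of ?_ ?_ (fun x => (hQm x).1) ?_
    · exact fun x y hxy => (hQm x).2.2 _ (hQm y).1 fun z hz =>
        (hQm y).2.1 z ⟨hz.1, hz.2.trans hxy⟩
    · intro l x
      refine (hQm _).2.2 _ (hA _ (hQm x).1 l) fun z hz i => ?_
      have h := (hQm x).2.1 _ ⟨hA z hz.1 (-l), fun j => by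
        have : z j ≤ l + x j := hz.2 j
        show -l + z j ≤ x j
        linarith⟩ i
      have h2 : -l + z i ≤ Qm x i := h
      show z i ≤ l + Qm x i
      linarith
    · exact fun x hx => le_antisymm ((hQm x).2.2 x hx fun z hz => hz.2)
        ((hQm x).2.1 x ⟨hx, le_rfl⟩)
  · refine retraction_of_opp ?_ ?_ (fun x => (hQp x).1) ?_
    · exact fun x y hxy => (hQp y).2.2 _ (hQp x).1 fun z hz =>
        (hQp x).2.1 z ⟨hz.1, hxy.trans hz.2⟩
    · intro l x
      refine (hQp _).2.2 _ (hA _ (hQp x).1 l) fun z hz i => ?_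
      have h := (hQp x).2.1 _ ⟨hA z hz.1 (-l), fun j => by
        have : l + x j ≤ z j := hz.2 j
        show x j ≤ -l + z j
        linarith⟩ i
      have h2 : Qp x i ≤ -l + z i := h
      show l + Qp x i ≤ z i
      linarith
    · exact fun x hx => le_antisymm ((hQp x).2.1 x ⟨hx, le_rfl⟩)
        ((hQp x).2.2 x hx fun z hz => hz.2)

end Ambitropical
end

section
/- Let C ⊆ ℝ^n be an additive cone. The following are equivalent: (1) C is closed in the Euclidean topology; (2) the limit of every bounded nondecreasing sequence of elements of C belongs to C; (3) the limit of every bounded nonincreasing sequence of elements of C belongs to C. -/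
open Set Filter Topology

namespace Ambitropical

variable {n : ℕ}

lemma exists_approx_seq {n : ℕ} (C : Set (Fin n → ℝ)) (hC : AdditiveCone C)
    (x : Fin n → ℝ) (hx : x ∈ closure C) (s : ℝ) :
    ∃ u : ℕ → Fin n → ℝ, (∀ k, u k ∈ C) ∧
      (∀ k i, |u k i - s * (1 / 4 : ℝ) ^ k - x i| ≤ (1 / 4 : ℝ) ^ k) ∧
      (∃ M : ℝ, ∀ k, ‖u k‖ ≤ M) ∧ Filter.Tendsto u Filter.atTop (nhds x) := by
  have h : ∀ k : ℕ, ∃ y ∈ C, dist x y < (1 / 4 : ℝ) ^ k := fun k =>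
    Metric.mem_closure_iff.1 hx _ (by positivity)
  choose y hyC hy using h
  have hb : ∀ k i, |s * (1 / 4 : ℝ) ^ k + y k i - s * (1 / 4 : ℝ) ^ k - x i| ≤ (1 / 4 : ℝ) ^ k := by
    intro k i
    have h1 := (dist_le_pi_dist x (y k) i).trans (hy k).le
    rw [dist_comm, Real.dist_eq] at h1
    rw [add_sub_cancel_left]
    exact h1
  have ht : Filter.Tendsto (fun k i => s * (1 / 4 : ℝ) ^ k + y k i) Filter.atTop (nhds x) := by
    have hp : Filter.Tendsto (fun k : ℕ => (1 / 4 : ℝ) ^ k) Filter.atTop (nhds 0) :=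
      tendsto_pow_atTop_nhds_zero_of_lt_one (by norm_num) (by norm_num)
    rw [tendsto_pi_nhds]
    intro i
    rw [tendsto_iff_dist_tendsto_zero]
    have hp2 : Filter.Tendsto (fun k : ℕ => (|s| + 1) * (1 / 4 : ℝ) ^ k) Filter.atTop (nhds 0) := by
      simpa using hp.const_mul (|s| + 1)
    refine squeeze_zero (fun _ => dist_nonneg) (fun k => ?_) hp2
    rw [Real.dist_eq]
    have h1 := hb k i
    have hq : (0 : ℝ) ≤ (1 / 4 : ℝ) ^ k := by positivity
    have h2 := abs_add_le (s * (1 / 4 : ℝ) ^ k)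
      (s * (1 / 4 : ℝ) ^ k + y k i - s * (1 / 4 : ℝ) ^ k - x i)
    rw [abs_mul, abs_of_nonneg hq] at h2
    have h3 : s * (1 / 4 : ℝ) ^ k + (s * (1 / 4 : ℝ) ^ k + y k i - s * (1 / 4 : ℝ) ^ k - x i)
      = s * (1 / 4 : ℝ) ^ k + y k i - x i := by ring
    rw [h3] at h2
    linarith
  refine ⟨fun k i => s * (1 / 4 : ℝ) ^ k + y k i, fun k => hC _ (hyC k) _, hb, ?_, ht⟩
  obtain ⟨M, hM⟩ := (Metric.isBounded_range_of_tendsto _ ht).exists_norm_le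
  exact ⟨M, fun k => hM _ ⟨k, rfl⟩⟩

/-- For an additive cone `C ⊆ ℝ^n`, the following are
equivalent: (1) `C` is closed; (2) `C` contains the limits of its bounded
nondecreasing sequences; (3) `C` contains the limits of its bounded
nonincreasing sequences. -/
theorem additiveCone_closed_iff_monotone_limits {n : ℕ}
    (C : Set (Fin n → ℝ)) (hC : AdditiveCone C) :
    (IsClosed C ↔
      ∀ u : ℕ → Fin n → ℝ, (∀ k, u k ∈ C) → Monotone u → (∃ M : ℝ, ∀ k, ‖u k‖ ≤ M) →
        ∀ x : Fin n → ℝ, Filter.Tendsto u Filter.atTop (nhds x) → x ∈ C) ∧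
    (IsClosed C ↔
      ∀ u : ℕ → Fin n → ℝ, (∀ k, u k ∈ C) → Antitone u → (∃ M : ℝ, ∀ k, ‖u k‖ ≤ M) →
        ∀ x : Fin n → ℝ, Filter.Tendsto u Filter.atTop (nhds x) → x ∈ C) := by
  refine ⟨⟨fun h u hu _ _ x hx => h.mem_of_tendsto hx (Filter.Eventually.of_forall hu), fun h => ?_⟩,
    ⟨fun h u hu _ _ x hx => h.mem_of_tendsto hx (Filter.Eventually.of_forall hu), fun h => ?_⟩⟩
  · refine isClosed_of_closure_subset fun x hx => ?_
    obtain ⟨u, hu, hb, hM, ht⟩ := exists_approx_seq C hC x hx (-2)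
    refine h u hu (monotone_nat_of_le_succ fun k i => ?_) hM x ht
    have h1 := abs_le.1 (hb k i)
    have h2 := abs_le.1 (hb (k + 1) i)
    have hq : (0 : ℝ) ≤ (1 / 4 : ℝ) ^ k := by positivity
    rw [pow_succ] at h2
    linarith [h1.2, h2.1]
  · refine isClosed_of_closure_subset fun x hx => ?_
    obtain ⟨u, hu, hb, hM, ht⟩ := exists_approx_seq C hC x hx 2
    refine h u hu (antitone_nat_of_succ_le fun k i => ?_) hM x ht
    have h1 := abs_le.1 (hb k i)
    have h2 := abs_le.1 (hb (k + 1) i)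
    have hq : (0 : ℝ) ≤ (1 / 4 : ℝ) ^ k := by positivity
    rw [pow_succ] at h2
    linarith [h1.1, h2.2]

end Ambitropical
end

section
/- Let E be a nonempty subset of ℝ^n. Then E^max is a closed tropical cone (an additive cone, closed in the Euclidean topology, and closed under binary componentwise suprema), and E^min is a closed dual tropical cone (an additive cone, closed, and closed under binary componentwise infima). -/
open Set Filter Topology

namespace Ambitropical

variable {n : ℕ}

theorem mem_maxGen_iff_aux {n : ℕ} (E : Set (Fin n → ℝ)) (hE : E.Nonempty) (x : Fin n → ℝ) :
    x ∈ MaxGen E ↔ ∀ i, ∀ ε > 0, ∃ f ∈ E, ∀ j, x i - f i - ε ≤ x j - f j := by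
  constructor
  · rintro ⟨S, hSE, -, lam, -, hl⟩ i ε hε
    obtain ⟨v, ⟨f, hf, rfl⟩, hv, -⟩ := (hl i).exists_between (sub_lt_self (x i) hε)
    refine ⟨f, hSE hf, fun j => ?_⟩
    have := (hl j).1 ⟨f, hf, rfl⟩
    linarith
  · intro h
    have hle : ∀ (f : Fin n → ℝ) (j), (⨅ k, (x k - f k)) ≤ x j - f j := fun f j =>
      ciInf_le (Set.finite_range _).bddBelow j
    refine ⟨E, subset_rfl, hE, fun f => ⨅ j, (x j - f j), ⟨x, fun f _ i => ?_⟩, fun i => ⟨?_, ?_⟩⟩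
    · have := hle f i
      simp only
      linarith
    · rintro v ⟨f, -, rfl⟩
      have := hle f i
      linarith
    · intro b hb
      refine le_of_forall_pos_le_add fun ε hε => ?_
      obtain ⟨f, hf, hfj⟩ := h i ε hε
      have h1 := hb ⟨f, hf, rfl⟩
      haveI : Nonempty (Fin n) := ⟨i⟩
      have h2 : x i - f i - ε ≤ ⨅ j, (x j - f j) := le_ciInf hfj
      linarith

theorem mem_minGen_iff_aux {n : ℕ} (E : Set (Fin n → ℝ)) (hE : E.Nonempty) (x : Fin n → ℝ) :
    x ∈ MinGen E ↔ ∀ i, ∀ ε > 0, ∃ f ∈ E, ∀ j, x j - f j ≤ x i - f i + ε := by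
  constructor
  · rintro ⟨S, hSE, -, lam, -, hl⟩ i ε hε
    obtain ⟨v, ⟨f, hf, rfl⟩, -, hv⟩ := (hl i).exists_between (lt_add_of_pos_right (x i) hε)
    refine ⟨f, hSE hf, fun j => ?_⟩
    have := (hl j).1 ⟨f, hf, rfl⟩
    linarith
  · intro h
    have hle : ∀ (f : Fin n → ℝ) (j), x j - f j ≤ (⨆ k, (x k - f k)) := fun f j =>
      le_ciSup (f := fun k => x k - f k) (Set.finite_range _).bddAbove j
    refine ⟨E, subset_rfl, hE, fun f => ⨆ j, (x j - f j), ⟨x, fun f _ i => ?_⟩, fun i => ⟨?_, ?_⟩⟩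
    · have := hle f i
      simp only
      linarith
    · rintro v ⟨f, -, rfl⟩
      have := hle f i
      linarith
    · intro b hb
      refine le_of_forall_pos_le_add fun ε hε => ?_
      obtain ⟨f, hf, hfj⟩ := h i ε hε
      have h1 := hb ⟨f, hf, rfl⟩
      haveI : Nonempty (Fin n) := ⟨i⟩
      have h2 : (⨆ j, (x j - f j)) ≤ x i - f i + ε := ciSup_le hfj
      linarith

theorem closure_approx_aux {n : ℕ} {C : Set (Fin n → ℝ)} {x : Fin n → ℝ} (hx : x ∈ closure C)
    {ε : ℝ} (hε : 0 < ε) : ∃ y ∈ C, ∀ j, x j - y j < ε ∧ y j - x j < ε := by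
  obtain ⟨y, hy, hd⟩ := Metric.mem_closure_iff.1 hx ε hε
  refine ⟨y, hy, fun j => ?_⟩
  have h := (dist_le_pi_dist x y j).trans_lt hd
  rw [Real.dist_eq, abs_lt] at h
  constructor <;> linarith [h.1, h.2]

/-- For every nonempty `E ⊆ ℝ^n`, the set `E^max` is a closed
tropical cone (an additive cone, closed in the Euclidean topology, stable by
binary componentwise suprema), and `E^min` is a closed dual tropical cone. -/
theorem maxGen_closed_tropical_and_minGen_closed_dual_tropical {n : ℕ}
    (E : Set (Fin n → ℝ)) (hE : E.Nonempty) :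
    (AdditiveCone (MaxGen E) ∧ IsClosed (MaxGen E) ∧
      ∀ x ∈ MaxGen E, ∀ y ∈ MaxGen E, x ⊔ y ∈ MaxGen E) ∧
    (AdditiveCone (MinGen E) ∧ IsClosed (MinGen E) ∧
      ∀ x ∈ MinGen E, ∀ y ∈ MinGen E, x ⊓ y ∈ MinGen E) := by
  refine ⟨⟨?_, ?_, ?_⟩, ?_, ?_, ?_⟩
  · intro x hx l
    rw [mem_maxGen_iff_aux E hE] at hx ⊢
    intro i ε hε
    obtain ⟨f, hf, h⟩ := hx i ε hε
    exact ⟨f, hf, fun j => by linarith [h j]⟩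
  · refine isClosed_of_closure_subset fun x hx => ?_
    rw [mem_maxGen_iff_aux E hE]
    intro i ε hε
    obtain ⟨y, hy, hxy⟩ := closure_approx_aux hx (show 0 < ε / 4 by linarith)
    rw [mem_maxGen_iff_aux E hE] at hy
    obtain ⟨f, hf, h⟩ := hy i (ε / 2) (by linarith)
    exact ⟨f, hf, fun j => by linarith [h j, (hxy i).1, (hxy j).2]⟩
  · intro x hx y hy
    rw [mem_maxGen_iff_aux E hE] at hx hy ⊢
    intro i ε hε
    simp only [Pi.sup_apply]
    rcases le_total (x i) (y i) with hi | hi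
    · obtain ⟨f, hf, h⟩ := hy i ε hε
      rw [sup_eq_right.2 hi]
      exact ⟨f, hf, fun j => by linarith [h j, le_sup_right (a := x j) (b := y j)]⟩
    · obtain ⟨f, hf, h⟩ := hx i ε hε
      rw [sup_eq_left.2 hi]
      exact ⟨f, hf, fun j => by linarith [h j, le_sup_left (a := x j) (b := y j)]⟩
  · intro x hx l
    rw [mem_minGen_iff_aux E hE] at hx ⊢
    intro i ε hε
    obtain ⟨f, hf, h⟩ := hx i ε hε
    exact ⟨f, hf, fun j => by linarith [h j]⟩
  · refine isClosed_of_closure_subset fun x hx => ?_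
    rw [mem_minGen_iff_aux E hE]
    intro i ε hε
    obtain ⟨y, hy, hxy⟩ := closure_approx_aux hx (show 0 < ε / 4 by linarith)
    rw [mem_minGen_iff_aux E hE] at hy
    obtain ⟨f, hf, h⟩ := hy i (ε / 2) (by linarith)
    exact ⟨f, hf, fun j => by linarith [h j, (hxy i).2, (hxy j).1]⟩
  · intro x hx y hy
    rw [mem_minGen_iff_aux E hE] at hx hy ⊢
    intro i ε hε
    simp only [Pi.inf_apply]
    rcases le_total (x i) (y i) with hi | hi
    · obtain ⟨f, hf, h⟩ := hx i ε hε
      rw [inf_eq_left.2 hi]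
      exact ⟨f, hf, fun j => by linarith [h j, inf_le_left (a := x j) (b := y j)]⟩
    · obtain ⟨f, hf, h⟩ := hy i ε hε
      rw [inf_eq_right.2 hi]
      exact ⟨f, hf, fun j => by linarith [h j, inf_le_right (a := x j) (b := y j)]⟩

end Ambitropical
end

section
/- For every closed ambitropical cone C ⊆ ℝ^n, the canonical retractions factor through the tropical projections: Q_C^- = P^min_C ∘ P^max_C and Q_C^+ = P^max_C ∘ P^min_C. -/
open Set Filter Topology

namespace Ambitropical

variable {n : ℕ}

theorem upperBounds_maxGen {C : Set (Fin n → ℝ)} (hC : AdditiveCone C) (x w : Fin n → ℝ) :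
    w ∈ upperBounds {y | y ∈ MaxGen C ∧ y ≤ x} ↔ ∀ y ∈ {y ∈ C | y ≤ x}, y ≤ w := by
  constructor
  · rintro h y ⟨hy, hyx⟩
    refine h ⟨⟨{y}, by simpa using hy, by simp, fun _ => 0, ⟨y, ?_⟩, ?_⟩, hyx⟩
    · rintro f rfl
      simp
    · intro i
      simp
  · rintro h y ⟨⟨S, hS, _, lam, _, hl⟩, hyx⟩ i
    refine (hl i).2 ?_
    rintro v ⟨f, hf, rfl⟩
    exact h (fun i => lam f + f i)
      ⟨hC f (hS hf) _, fun j => ((hl j).1 ⟨f, hf, rfl⟩).trans (hyx j)⟩ i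

theorem lowerBounds_minGen {C : Set (Fin n → ℝ)} (hC : AdditiveCone C) (x w : Fin n → ℝ) :
    w ∈ lowerBounds {y | y ∈ MinGen C ∧ x ≤ y} ↔ ∀ y ∈ {y ∈ C | x ≤ y}, w ≤ y := by
  constructor
  · rintro h y ⟨hy, hyx⟩
    refine h ⟨⟨{y}, by simpa using hy, by simp, fun _ => 0, ⟨y, ?_⟩, ?_⟩, hyx⟩
    · rintro f rfl
      simp
    · intro i
      simp
  · rintro h y ⟨⟨S, hS, _, lam, _, hl⟩, hyx⟩ i
    refine (hl i).2 ?_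
    rintro v ⟨f, hf, rfl⟩
    exact h (fun i => lam f + f i)
      ⟨hC f (hS hf) _, fun j => (hyx j).trans ((hl j).1 ⟨f, hf, rfl⟩)⟩ i

/-- For every closed ambitropical cone `C ⊆ ℝ^n`, the canonical
retractions factor through the tropical projections:
`Q_C^- = P^min_C ∘ P^max_C` and `Q_C^+ = P^max_C ∘ P^min_C`. -/
theorem canonical_retractions_factorization {n : ℕ}
    (C : Set (Fin n → ℝ)) (hC : IsAmbitropicalCone C) (hcl : IsClosed C)
    (Qm Qp Pmax Pmin : (Fin n → ℝ) → Fin n → ℝ)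
    (hQm : IsQminusMap C Qm) (hQp : IsQplusMap C Qp)
    (hPmax : IsPmaxMap C Pmax) (hPmin : IsPminMap C Pmin) :
    Qm = Pmin ∘ Pmax ∧ Qp = Pmax ∘ Pmin := by
  have hA := hC.2.1
  constructor
  · funext x
    obtain ⟨hq, hub, hle⟩ := hQm x
    have hp := hPmax x
    have h2 := hPmin (Pmax x)
    refine le_antisymm (h2.2 ?_) ?_
    · rw [lowerBounds_minGen hA]
      rintro w ⟨hw, hpw⟩
      exact hle w hw fun y hy => ((upperBounds_maxGen hA x _).1 hp.1 y hy).trans hpw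
    · exact (lowerBounds_minGen hA _ _).1 h2.1 _ ⟨hq, hp.2 ((upperBounds_maxGen hA x _).2 hub)⟩
  · funext x
    obtain ⟨hq, hlb, hge⟩ := hQp x
    have hp := hPmin x
    have h2 := hPmax (Pmin x)
    refine le_antisymm ?_ (h2.2 ?_)
    · exact (upperBounds_maxGen hA _ _).1 h2.1 _ ⟨hq, hp.2 ((lowerBounds_minGen hA x _).2 hlb)⟩
    · rw [upperBounds_maxGen hA]
      rintro w ⟨hw, hpw⟩
      exact hge w hw fun y hy => hpw.trans ((lowerBounds_minGen hA x _).1 hp.1 y hy)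

end Ambitropical
end

section
/- If C ⊆ ℝ^n is a nonempty closed tropical cone, then the projection P^max_C is a sunny retraction onto C: for all x ∈ ℝ^n and all t ∈ [0,1], P^max_C((1−t)·P^max_C(x) + t·x) = P^max_C(x). Dually, if C is a nonempty closed dual tropical cone, then P^min_C is sunny. -/
open Set Filter Topology

namespace Ambitropical

variable {n : ℕ}

/-- A closed set stable by max contains the suprema of its nonempty subsets. -/
lemma isLUB_mem_of_closed {n : ℕ} {C A : Set (Fin n → ℝ)} (hsup : ∀ x ∈ C, ∀ y ∈ C, x ⊔ y ∈ C)
    (hC : IsClosed C) (hA : A ⊆ C) (hAne : A.Nonempty) {a : Fin n → ℝ} (ha : IsLUB A a) :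
    a ∈ C := by
  let D : Set (Fin n → ℝ) := {y | y ∈ C ∧ y ≤ a}
  obtain ⟨b, hb⟩ := hAne
  have : Nonempty D := ⟨⟨b, hA hb, ha.1 hb⟩⟩
  have : IsDirectedOrder D := ⟨fun u v => ⟨⟨u.1 ⊔ v.1, hsup _ u.2.1 _ v.2.1,
    sup_le u.2.2 v.2.2⟩, Subtype.coe_le_coe.1 le_sup_left, Subtype.coe_le_coe.1 le_sup_right⟩⟩
  have hm : Monotone (fun d : D => d.1) := fun _ _ h => h
  have hl : IsLUB (Set.range (fun d : D => d.1)) a := by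
    refine ⟨?_, fun w hw => ha.2 fun y hy => hw ⟨⟨y, hA hy, ha.1 hy⟩, rfl⟩⟩
    rintro _ ⟨d, rfl⟩
    exact d.2.2
  exact hC.mem_of_tendsto (tendsto_atTop_isLUB hm hl) (Eventually.of_forall fun d => d.2.1)

lemma isGLB_mem_of_closed {n : ℕ} {C A : Set (Fin n → ℝ)} (hinf : ∀ x ∈ C, ∀ y ∈ C, x ⊓ y ∈ C)
    (hC : IsClosed C) (hA : A ⊆ C) (hAne : A.Nonempty) {a : Fin n → ℝ} (ha : IsGLB A a) :
    a ∈ C := by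
  let D : Set (Fin n → ℝ) := {y | y ∈ C ∧ a ≤ y}
  obtain ⟨b, hb⟩ := hAne
  have : Nonempty D := ⟨⟨b, hA hb, ha.1 hb⟩⟩
  have : IsCodirectedOrder D := ⟨fun u v => ⟨⟨u.1 ⊓ v.1, hinf _ u.2.1 _ v.2.1,
    le_inf u.2.2 v.2.2⟩, Subtype.coe_le_coe.1 inf_le_left, Subtype.coe_le_coe.1 inf_le_right⟩⟩
  have hm : Monotone (fun d : D => d.1) := fun _ _ h => h
  have hl : IsGLB (Set.range (fun d : D => d.1)) a := by
    refine ⟨?_, fun w hw => ha.2 fun y hy => hw ⟨⟨y, hA hy, ha.1 hy⟩, rfl⟩⟩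
    rintro _ ⟨d, rfl⟩
    exact d.2.2
  exact hC.mem_of_tendsto (tendsto_atBot_isGLB hm hl) (Eventually.of_forall fun d => d.2.1)

lemma maxGen_eq {n : ℕ} {C : Set (Fin n → ℝ)} (h : TropicalCone C) (hC : IsClosed C) :
    MaxGen C = C := by
  apply Set.Subset.antisymm
  · rintro x ⟨S, hS, ⟨g, hg⟩, lam, -, hx⟩
    refine isLUB_mem_of_closed (A := {y | ∃ f ∈ S, y = fun i => lam f + f i}) h.2 hC ?_
      ⟨_, g, hg, rfl⟩ ⟨?_, ?_⟩
    · rintro _ ⟨f, hf, rfl⟩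
      exact h.1 f (hS hf) _
    · rintro _ ⟨f, hf, rfl⟩ i
      exact (hx i).1 ⟨f, hf, rfl⟩
    · intro w hw i
      refine (hx i).2 ?_
      rintro _ ⟨f, hf, rfl⟩
      exact hw ⟨f, hf, rfl⟩ i
  · intro x hx
    refine ⟨{x}, by simpa using hx, ⟨x, rfl⟩, fun _ => 0, ⟨x, ?_⟩, fun i => ?_⟩
    · rintro f rfl i
      simp
    · simp

lemma minGen_eq {n : ℕ} {C : Set (Fin n → ℝ)} (h : DualTropicalCone C) (hC : IsClosed C) :
    MinGen C = C := by
  apply Set.Subset.antisymm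
  · rintro x ⟨S, hS, ⟨g, hg⟩, lam, -, hx⟩
    refine isGLB_mem_of_closed (A := {y | ∃ f ∈ S, y = fun i => lam f + f i}) h.2 hC ?_
      ⟨_, g, hg, rfl⟩ ⟨?_, ?_⟩
    · rintro _ ⟨f, hf, rfl⟩
      exact h.1 f (hS hf) _
    · rintro _ ⟨f, hf, rfl⟩ i
      exact (hx i).1 ⟨f, hf, rfl⟩
    · intro w hw i
      refine (hx i).2 ?_
      rintro _ ⟨f, hf, rfl⟩
      exact hw ⟨f, hf, rfl⟩ i
  · intro x hx
    refine ⟨{x}, by simpa using hx, ⟨x, rfl⟩, fun _ => 0, ⟨x, ?_⟩, fun i => ?_⟩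
    · rintro f rfl i
      simp
    · simp

lemma abs_le_sum_abs {n : ℕ} (c z : Fin n → ℝ) (i : Fin n) :
    |z i - c i| ≤ ∑ j, |z j - c j| :=
  Finset.single_le_sum (f := fun j => |z j - c j|) (fun j _ => abs_nonneg _) (Finset.mem_univ i)

/-- If `C ⊆ ℝ^n` is a nonempty closed tropical cone, then
`P^max_C` is a sunny retraction onto `C`; dually, if `C` is a nonempty closed
dual tropical cone, then `P^min_C` is a sunny retraction onto `C`. -/
theorem tropical_projection_is_sunny {n : ℕ}
    (C : Set (Fin n → ℝ)) (hne : C.Nonempty) :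
    (TropicalCone C → IsClosed C → ∀ P : (Fin n → ℝ) → Fin n → ℝ, IsPmaxMap C P →
      Set.range P = C ∧ (∀ y ∈ C, P y = y) ∧
      ∀ x : Fin n → ℝ, ∀ t ∈ Set.Icc (0 : ℝ) 1,
        P ((1 - t) • P x + t • x) = P x) ∧
    (DualTropicalCone C → IsClosed C → ∀ P : (Fin n → ℝ) → Fin n → ℝ, IsPminMap C P →
      Set.range P = C ∧ (∀ y ∈ C, P y = y) ∧
      ∀ x : Fin n → ℝ, ∀ t ∈ Set.Icc (0 : ℝ) 1,
        P ((1 - t) • P x + t • x) = P x) := by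
  obtain ⟨c, hc⟩ := hne
  constructor
  · intro h hC P hP
    have hP' : ∀ z, IsLUB {y | y ∈ C ∧ y ≤ z} (P z) := by
      intro z
      have := hP z
      rwa [maxGen_eq h hC] at this
    have hmem : ∀ z, P z ∈ C := by
      intro z
      refine isLUB_mem_of_closed (A := {y | y ∈ C ∧ y ≤ z}) h.2 hC (fun y hy => hy.1) ⟨_, h.1 c hc (-∑ j, |z j - c j|), ?_⟩
        (hP' z)
      intro i
      have h1 := abs_le_sum_abs c z i
      have h2 := neg_abs_le (z i - c i)
      show -∑ j, |z j - c j| + c i ≤ z i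
      linarith
    have hle : ∀ z, P z ≤ z := fun z => (hP' z).2 fun y hy => hy.2
    have hfix : ∀ y ∈ C, P y = y := fun y hy => le_antisymm (hle y) ((hP' y).1 ⟨hy, le_rfl⟩)
    refine ⟨Set.Subset.antisymm ?_ (fun y hy => Set.mem_range.2 ⟨y, hfix y hy⟩), hfix, ?_⟩
    · rintro _ ⟨z, rfl⟩
      exact hmem z
    · rintro x t ⟨ht0, ht1⟩
      apply le_antisymm
      · refine (hP' x).1 ⟨hmem _, (hle _).trans fun i => ?_⟩
        have := hle x i
        simp only [Pi.add_apply, Pi.smul_apply, smul_eq_mul]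
        nlinarith
      · refine (hP' _).1 ⟨hmem _, fun i => ?_⟩
        have := hle x i
        simp only [Pi.add_apply, Pi.smul_apply, smul_eq_mul]
        nlinarith
  · intro h hC P hP
    have hP' : ∀ z, IsGLB {y | y ∈ C ∧ z ≤ y} (P z) := by
      intro z
      have := hP z
      rwa [minGen_eq h hC] at this
    have hmem : ∀ z, P z ∈ C := by
      intro z
      refine isGLB_mem_of_closed (A := {y | y ∈ C ∧ z ≤ y}) h.2 hC (fun y hy => hy.1) ⟨_, h.1 c hc (∑ j, |z j - c j|), ?_⟩
        (hP' z)
      intro i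
      have h1 := abs_le_sum_abs c z i
      have h2 := le_abs_self (z i - c i)
      show z i ≤ ∑ j, |z j - c j| + c i
      linarith
    have hle : ∀ z, z ≤ P z := fun z => (hP' z).2 fun y hy => hy.2
    have hfix : ∀ y ∈ C, P y = y := fun y hy => le_antisymm ((hP' y).1 ⟨hy, le_rfl⟩) (hle y)
    refine ⟨Set.Subset.antisymm ?_ (fun y hy => Set.mem_range.2 ⟨y, hfix y hy⟩), hfix, ?_⟩
    · rintro _ ⟨z, rfl⟩
      exact hmem z
    · rintro x t ⟨ht0, ht1⟩
      apply le_antisymm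
      · refine (hP' _).1 ⟨hmem _, fun i => ?_⟩
        have := hle x i
        simp only [Pi.add_apply, Pi.smul_apply, smul_eq_mul]
        nlinarith
      · refine (hP' x).1 ⟨hmem _, le_trans (fun i => ?_) (hle _)⟩
        have := hle x i
        simp only [Pi.add_apply, Pi.smul_apply, smul_eq_mul]
        nlinarith

end Ambitropical
end

section
/- Let E be a nonempty subset of ℝ^n, and for z ∈ ℝ^n set B_E(z) = ⋂_{y∈E} {x ∈ ℝ^n : y + b(z−y) ≤ x ≤ y + t(z−y)}, where t(u) = max_i u_i and b(u) = min_i u_i. Then B_E(z) = {x ∈ ℝ^n : P^max_E(z) ≤ x ≤ P^min_E(z)}; in particular P^max_E(z) = sup_{y∈E}(b(z−y) + y) and P^min_E(z) = inf_{y∈E}(t(z−y) + y). -/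
open Set Filter Topology

namespace Ambitropical

variable {n : ℕ}

theorem bmin_le (u : Fin n → ℝ) (i : Fin n) : bmin u ≤ u i :=
  ciInf_le (Set.finite_range u).bddBelow i

theorem le_tmax (u : Fin n → ℝ) (i : Fin n) : u i ≤ tmax u :=
  le_ciSup (Set.finite_range u).bddAbove i

theorem pmax_aux (hn : 0 < n) (E : Set (Fin n → ℝ))
    (P : (Fin n → ℝ) → Fin n → ℝ) (hP : IsPmaxMap E P) (z : Fin n → ℝ) :
    IsLUB {v | ∃ y ∈ E, v = fun i => bmin (z - y) + y i} (P z) := by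
  haveI : Nonempty (Fin n) := ⟨⟨0, hn⟩⟩
  constructor
  · rintro v ⟨y, hy, rfl⟩
    refine (hP z).1 ⟨⟨{y}, by simpa using hy, ⟨y, rfl⟩, fun _ => bmin (z - y), ⟨fun i => bmin (z - y) + y i, ?_⟩, ?_⟩, ?_⟩
    · rintro f rfl
      exact le_rfl
    · intro i
      simp
    · intro i
      have := bmin_le (z - y) i
      simp only [Pi.sub_apply] at this
      show bmin (z - y) + y i ≤ z i
      linarith
  · intro w hw
    refine (hP z).2 ?_
    rintro x ⟨⟨S, hS, -, lam, -, hx⟩, hxz⟩ i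
    refine (hx i).2 ?_
    rintro v ⟨f, hf, rfl⟩
    have h1 : lam f ≤ bmin (z - f) := by
      refine le_ciInf fun j => ?_
      have h2 := (hx j).1 ⟨f, hf, rfl⟩
      have h3 := hxz j
      simp only [Pi.sub_apply]
      linarith
    have h4 : bmin (z - f) + f i ≤ w i := hw ⟨f, hS hf, rfl⟩ i
    linarith

theorem pmin_aux (hn : 0 < n) (E : Set (Fin n → ℝ))
    (P : (Fin n → ℝ) → Fin n → ℝ) (hP : IsPminMap E P) (z : Fin n → ℝ) :
    IsGLB {v | ∃ y ∈ E, v = fun i => tmax (z - y) + y i} (P z) := by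
  haveI : Nonempty (Fin n) := ⟨⟨0, hn⟩⟩
  constructor
  · rintro v ⟨y, hy, rfl⟩
    refine (hP z).1 ⟨⟨{y}, by simpa using hy, ⟨y, rfl⟩, fun _ => tmax (z - y), ⟨fun i => tmax (z - y) + y i, ?_⟩, ?_⟩, ?_⟩
    · rintro f rfl
      exact le_rfl
    · intro i
      simp
    · intro i
      have := le_tmax (z - y) i
      simp only [Pi.sub_apply] at this
      show z i ≤ tmax (z - y) + y i
      linarith
  · intro w hw
    refine (hP z).2 ?_
    rintro x ⟨⟨S, hS, -, lam, -, hx⟩, hxz⟩ i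
    refine (hx i).2 ?_
    rintro v ⟨f, hf, rfl⟩
    have h1 : tmax (z - f) ≤ lam f := by
      refine ciSup_le fun j => ?_
      have h2 := (hx j).1 ⟨f, hf, rfl⟩
      have h3 := hxz j
      simp only [Pi.sub_apply]
      linarith
    have h4 : w i ≤ tmax (z - f) + f i := hw ⟨f, hS hf, rfl⟩ i
    linarith

/-- For nonempty `E ⊆ ℝ^n` and `z ∈ ℝ^n`, the set
`B_E(z) = ⋂_{y ∈ E} {x ∣ y + b(z-y) ≤ x ≤ y + t(z-y)}` coincides with the order
interval `[P^max_E(z), P^min_E(z)]`; in particular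
`P^max_E(z) = sup_{y ∈ E} (b(z-y) + y)` and `P^min_E(z) = inf_{y ∈ E} (t(z-y) + y)`. -/
theorem best_coapproximation_ball_characterization {n : ℕ} (hn : 0 < n)
    (E : Set (Fin n → ℝ)) (hE : E.Nonempty)
    (Pmax Pmin : (Fin n → ℝ) → Fin n → ℝ)
    (hPmax : IsPmaxMap E Pmax) (hPmin : IsPminMap E Pmin) (z : Fin n → ℝ) :
    ({x | ∀ y ∈ E, (fun i => bmin (z - y) + y i) ≤ x ∧ x ≤ fun i => tmax (z - y) + y i}
        = {x | Pmax z ≤ x ∧ x ≤ Pmin z}) ∧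
    IsLUB {v | ∃ y ∈ E, v = fun i => bmin (z - y) + y i} (Pmax z) ∧
    IsGLB {v | ∃ y ∈ E, v = fun i => tmax (z - y) + y i} (Pmin z) := by
  have hM := pmax_aux hn E Pmax hPmax z
  have hm := pmin_aux hn E Pmin hPmin z
  refine ⟨?_, hM, hm⟩
  ext x
  constructor
  · intro hx
    refine ⟨hM.2 ?_, hm.2 ?_⟩
    · rintro v ⟨y, hy, rfl⟩
      exact (hx y hy).1
    · rintro v ⟨y, hy, rfl⟩
      exact (hx y hy).2
  · rintro ⟨h1, h2⟩ y hy
    exact ⟨(hM.1 ⟨y, hy, rfl⟩).trans h1, h2.trans (hm.1 ⟨y, hy, rfl⟩)⟩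

end Ambitropical
end

section
/- Let E be a nonempty subset of ℝ^n included in a closed ambitropical cone F. Then E^max ∩ E^min ⊆ F. In particular, every closed ambitropical cone C satisfies C = C^max ∩ C^min. -/
open Set Filter Topology

namespace Ambitropical

variable {n : ℕ}

theorem exists_finite_lub {F : Set (Fin n → ℝ)} (hF : IsAmbitropicalCone F)
    (a0 : Fin n → ℝ) (h0 : a0 ∈ F) (a : Fin n → Fin n → ℝ) (ha : ∀ i, a i ∈ F)
    (s : Finset (Fin n)) :
    ∃ z ∈ F, (∀ i ∈ s, a i ≤ z) ∧
      ∀ w ∈ F, a0 ≤ w → (∀ i, a i ≤ w) → z ≤ w := by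
  induction s using Finset.induction_on with
  | empty => exact ⟨a0, h0, by simp, fun w _ h _ => h⟩
  | insert j s hj ih =>
    obtain ⟨z, hz, hz1, hz2⟩ := ih
    obtain ⟨z', hz', hub, hlub⟩ := (hF.2.2 z hz (a j) (ha j)).1
    refine ⟨z', hz', ?_, ?_⟩
    · intro i hi
      rcases Finset.mem_insert.1 hi with rfl | hi
      · exact hub _ (by simp)
      · exact (hz1 i hi).trans (hub z (by simp))
    · intro w hw hw0 hwa
      apply hlub w hw
      intro x hx
      rcases hx with rfl | hx
      · exact hz2 w hw hw0 hwa
      · rw [Set.mem_singleton_iff.1 hx]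
        exact hwa j

theorem inter_subset_aux (E F : Set (Fin n → ℝ)) (hEF : E ⊆ F)
    (hF : IsAmbitropicalCone F) (hFcl : IsClosed F) :
    MaxGen E ∩ MinGen E ⊆ F := by
  rintro x ⟨⟨S, hSE, ⟨f0, hf0⟩, lam, -, hlub⟩, ⟨T, hTE, -, mu, -, hglb⟩⟩
  rw [← hFcl.closure_eq, Metric.mem_closure_iff]
  intro ε hε
  have hex : ∀ i, ∃ f ∈ S, x i - ε / 2 < lam f + f i := by
    intro i
    obtain ⟨v, ⟨f, hf, rfl⟩, hv, -⟩ := (hlub i).exists_between (show x i - ε / 2 < x i by linarith)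
    exact ⟨f, hf, hv⟩
  choose f hfS hf using hex
  obtain ⟨z, hzF, hz1, hz2⟩ := exists_finite_lub hF (fun k => lam f0 + f0 k)
    (hF.2.1 f0 (hEF (hSE hf0)) _) (fun i k => lam (f i) + f i k)
    (fun i => hF.2.1 (f i) (hEF (hSE (hfS i))) _) Finset.univ
  refine ⟨z, hzF, ?_⟩
  have hle : ∀ h ∈ S, ∀ k, lam h + h k ≤ x k := fun h hh k => (hlub k).1 ⟨h, hh, rfl⟩
  have hzx : ∀ k, z k ≤ x k := by
    intro k
    apply (hglb k).2
    rintro v ⟨g, hg, rfl⟩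
    have hxg : ∀ k, x k ≤ mu g + g k := fun k => (hglb k).1 ⟨g, hg, rfl⟩
    exact hz2 (fun k => mu g + g k) (hF.2.1 g (hEF (hTE hg)) _)
      (fun k => (hle f0 hf0 k).trans (hxg k))
      (fun i k => (hle (f i) (hfS i) k).trans (hxg k)) k
  have : dist x z ≤ ε / 2 := by
    rw [dist_pi_le_iff (by positivity)]
    intro k
    have h1 := hz1 k (Finset.mem_univ k) k
    have h2 := hf k
    have h3 := hzx k
    simp only at h1
    rw [Real.dist_eq, abs_le]
    constructor <;> linarith
  linarith

/-- If a nonempty `E ⊆ ℝ^n` is included in a closed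
ambitropical cone `F`, then `E^max ∩ E^min ⊆ F`; in particular every closed
ambitropical cone `C` satisfies `C = C^max ∩ C^min`. -/
theorem maxGen_inter_minGen_subset {n : ℕ}
    (E F : Set (Fin n → ℝ)) (hE : E.Nonempty) (hEF : E ⊆ F)
    (hF : IsAmbitropicalCone F) (hFcl : IsClosed F) :
    MaxGen E ∩ MinGen E ⊆ F ∧
    ∀ C : Set (Fin n → ℝ), IsAmbitropicalCone C → IsClosed C →
      C = MaxGen C ∩ MinGen C := by
  refine ⟨inter_subset_aux E F hEF hF hFcl, fun C hC hCcl => ?_⟩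
  refine Set.Subset.antisymm (fun x hx => ⟨?_, ?_⟩) (inter_subset_aux C C subset_rfl hC hCcl)
  · refine ⟨{x}, by simpa using hx, ⟨x, rfl⟩, fun _ => 0, ⟨x, ?_⟩, fun i => ?_⟩
    · intro f hf i
      simp [Set.mem_singleton_iff.1 hf]
    · simp [isLUB_singleton]
  · refine ⟨{x}, by simpa using hx, ⟨x, rfl⟩, fun _ => 0, ⟨x, ?_⟩, fun i => ?_⟩
    · intro f hf i
      simp [Set.mem_singleton_iff.1 hf]
    · simp [isGLB_singleton]

end Ambitropical
end

section
/- Let E be a nonempty subset of ℝ^n, and set barQ^-_E = P^min_E ∘ P^max_E and barQ^+_E = P^max_E ∘ P^min_E. Then the ranges of barQ^-_E and barQ^+_E are closed ambitropical cones containing E, and barQ^+_E restricts to a bijection from range(barQ^-_E) onto range(barQ^+_E) whose inverse is the restriction of barQ^-_E; in particular the two ranges are isomorphic via Shapley operators. -/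
open Set Filter Topology

namespace Ambitropical

variable {n : ℕ}

theorem shapley_continuous (T : (Fin n → ℝ) → Fin n → ℝ) (hT : IsShapley T) : Continuous T := by
  have key : ∀ x y : Fin n → ℝ, ∀ i, T y i ≤ dist x y + T x i := by
    intro x y i
    have h : y ≤ fun j => dist x y + x j := by
      intro j
      have h1 := dist_le_pi_dist x y j
      rw [Real.dist_eq] at h1
      have h2 := (abs_le.mp h1).1
      show y j ≤ dist x y + x j
      linarith
    have h3 := hT.1 h i
    rw [hT.2] at h3
    exact h3
  apply LipschitzWith.continuous (K := 1)
  apply LipschitzWith.of_dist_le_mul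
  intro x y
  rw [NNReal.coe_one, one_mul, dist_pi_le_iff dist_nonneg]
  intro i
  rw [Real.dist_eq, abs_le]
  have h1 := key x y i
  have h2 := key y x i
  rw [dist_comm] at h2
  constructor <;> linarith

theorem range_of_idem (E : Set (Fin n → ℝ)) (hE : E.Nonempty)
    (T : (Fin n → ℝ) → Fin n → ℝ) (hT : IsShapley T) (hid : ∀ x, T (T x) = T x)
    (hfix : ∀ x ∈ E, T x = x) :
    IsAmbitropicalCone (Set.range T) ∧ IsClosed (Set.range T) ∧ E ⊆ Set.range T := by
  have hsub : E ⊆ Set.range T := fun x hx => ⟨x, hfix x hx⟩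
  have hr : ∀ x ∈ Set.range T, T x = x := by
    rintro _ ⟨x, rfl⟩
    exact hid x
  refine ⟨⟨hE.mono hsub, ?_, ?_⟩, ?_, hsub⟩
  · intro x hx l
    exact ⟨fun i => l + x i, by rw [hT.2, hr x hx]⟩
  · intro x hx y hy
    refine ⟨⟨T (x ⊔ y), ⟨_, rfl⟩, ?_, ?_⟩, ⟨T (x ⊓ y), ⟨_, rfl⟩, ?_, ?_⟩⟩
    · rintro z (rfl | rfl)
      · rw [← hr z hx, hr z hx]
        exact (hr z hx).symm.le.trans (hT.1 le_sup_left)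
      · exact (hr z hy).symm.le.trans (hT.1 le_sup_right)
    · intro w hw h
      rw [← hr w hw]
      exact hT.1 (sup_le (h x (by simp)) (h y (by simp)))
    · rintro z (rfl | rfl)
      · exact (hT.1 inf_le_left).trans (hr z hx).le
      · exact (hT.1 inf_le_right).trans (hr z hy).le
    · intro w hw h
      rw [← hr w hw]
      exact hT.1 (le_inf (h x (by simp)) (h y (by simp)))
  · have : Set.range T = {x | T x = x} := by
      ext x
      exact ⟨hr x, fun h => ⟨x, h⟩⟩
    rw [this]
    exact isClosed_eq (shapley_continuous T hT) continuous_id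

theorem maxGen_add {E : Set (Fin n → ℝ)} {x : Fin n → ℝ} (hx : x ∈ MaxGen E) (l : ℝ) :
    (fun i => l + x i) ∈ MaxGen E := by
  obtain ⟨S, hS, hne, lam, ⟨u, hu⟩, h⟩ := hx
  refine ⟨S, hS, hne, fun f => l + lam f, ⟨fun i => l + u i, fun f hf i => ?_⟩, fun i => ⟨?_, ?_⟩⟩
  · have := hu f hf i
    simp only at this ⊢
    linarith
  · rintro _ ⟨f, hf, rfl⟩
    have := (h i).1 ⟨f, hf, rfl⟩
    linarith
  · intro b hb
    have : x i ≤ b - l := (h i).2 (by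
      rintro _ ⟨f, hf, rfl⟩
      have := hb ⟨f, hf, rfl⟩
      linarith)
    linarith

theorem minGen_add {E : Set (Fin n → ℝ)} {x : Fin n → ℝ} (hx : x ∈ MinGen E) (l : ℝ) :
    (fun i => l + x i) ∈ MinGen E := by
  obtain ⟨S, hS, hne, lam, ⟨u, hu⟩, h⟩ := hx
  refine ⟨S, hS, hne, fun f => l + lam f, ⟨fun i => l + u i, fun f hf i => ?_⟩, fun i => ⟨?_, ?_⟩⟩
  · have := hu f hf i
    simp only at this ⊢
    linarith
  · rintro _ ⟨f, hf, rfl⟩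
    have := (h i).1 ⟨f, hf, rfl⟩
    linarith
  · intro b hb
    have : b - l ≤ x i := (h i).2 (by
      rintro _ ⟨f, hf, rfl⟩
      have := hb ⟨f, hf, rfl⟩
      linarith)
    linarith

theorem subset_maxGen {E : Set (Fin n → ℝ)} {x : Fin n → ℝ} (hx : x ∈ E) : x ∈ MaxGen E := by
  refine ⟨{x}, by simpa using hx, ⟨x, rfl⟩, fun _ => 0, ⟨x, ?_⟩, fun i => ?_⟩
  · rintro f rfl i
    simp
  · simp

theorem subset_minGen {E : Set (Fin n → ℝ)} {x : Fin n → ℝ} (hx : x ∈ E) : x ∈ MinGen E := by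
  refine ⟨{x}, by simpa using hx, ⟨x, rfl⟩, fun _ => 0, ⟨x, ?_⟩, fun i => ?_⟩
  · rintro f rfl i
    simp
  · simp

theorem pmax_shapley {E : Set (Fin n → ℝ)} {P : (Fin n → ℝ) → Fin n → ℝ} (h : IsPmaxMap E P) :
    IsShapley P := by
  have key : ∀ (l : ℝ) (z : Fin n → ℝ) (i : Fin n), l + P z i ≤ P (fun i => l + z i) i := by
    intro l z i
    have : P z ≤ fun i => -l + P (fun i => l + z i) i := (h z).2 (by
      rintro y ⟨hy, hyz⟩ j
      have h1 := (h (fun i => l + z i)).1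
        ⟨maxGen_add hy l, fun k => by have := hyz k; simp only; linarith⟩ j
      simp only at h1 ⊢
      linarith)
    have := this i
    simp only at this
    linarith
  refine ⟨fun x y hxy => (h x).2 fun z hz => (h y).1 ⟨hz.1, hz.2.trans hxy⟩, fun l x => ?_⟩
  funext i
  apply le_antisymm _ (key l x i)
  have := key (-l) (fun i => l + x i) i
  simp only [neg_add_cancel_left] at this
  linarith

theorem pmin_shapley {E : Set (Fin n → ℝ)} {P : (Fin n → ℝ) → Fin n → ℝ} (h : IsPminMap E P) :
    IsShapley P := by
  have key : ∀ (l : ℝ) (z : Fin n → ℝ) (i : Fin n), P (fun i => l + z i) i ≤ l + P z i := by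
    intro l z i
    have : (fun i => -l + P (fun i => l + z i) i) ≤ P z := (h z).2 (by
      rintro y ⟨hy, hyz⟩ j
      have h1 := (h (fun i => l + z i)).1
        ⟨minGen_add hy l, fun k => by have := hyz k; simp only; linarith⟩ j
      simp only at h1 ⊢
      linarith)
    have := this i
    simp only at this
    linarith
  refine ⟨fun x y hxy => (h y).2 fun z hz => (h x).1 ⟨hz.1, hxy.trans hz.2⟩, fun l x => ?_⟩
  funext i
  apply le_antisymm (key l x i)
  have := key (-l) (fun i => l + x i) i
  simp only [neg_add_cancel_left] at this
  linarith

theorem IsShapley.comp' {S T : (Fin n → ℝ) → Fin n → ℝ} (hS : IsShapley S) (hT : IsShapley T) :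
    IsShapley (S ∘ T) :=
  ⟨hS.1.comp hT.1, fun l x => by simp only [Function.comp, hT.2, hS.2]⟩

/-- For nonempty `E ⊆ ℝ^n`, with `Q⁻ = P^min_E ∘ P^max_E`
and `Q⁺ = P^max_E ∘ P^min_E`, the ranges of `Q⁻` and `Q⁺` are closed
ambitropical cones containing `E`, and `Q⁺` restricts to a bijection from
`range Q⁻` onto `range Q⁺` whose inverse is the restriction of `Q⁻`. -/
theorem ranges_of_barQ_are_closed_ambitropical_and_isomorphic {n : ℕ}
    (E : Set (Fin n → ℝ)) (hE : E.Nonempty)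
    (Pmax Pmin : (Fin n → ℝ) → Fin n → ℝ)
    (hPmax : IsPmaxMap E Pmax) (hPmin : IsPminMap E Pmin) :
    (IsAmbitropicalCone (Set.range (Pmin ∘ Pmax)) ∧
      IsClosed (Set.range (Pmin ∘ Pmax)) ∧ E ⊆ Set.range (Pmin ∘ Pmax)) ∧
    (IsAmbitropicalCone (Set.range (Pmax ∘ Pmin)) ∧
      IsClosed (Set.range (Pmax ∘ Pmin)) ∧ E ⊆ Set.range (Pmax ∘ Pmin)) ∧
    Set.BijOn (Pmax ∘ Pmin) (Set.range (Pmin ∘ Pmax)) (Set.range (Pmax ∘ Pmin)) ∧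
    (∀ x ∈ Set.range (Pmin ∘ Pmax), (Pmin ∘ Pmax) ((Pmax ∘ Pmin) x) = x) ∧
    (∀ y ∈ Set.range (Pmax ∘ Pmin), (Pmax ∘ Pmin) ((Pmin ∘ Pmax) y) = y) := by
  have sM := pmax_shapley hPmax
  have sm := pmin_shapley hPmin
  have leM : ∀ z, Pmax z ≤ z := fun z => (hPmax z).2 fun y hy => hy.2
  have lem : ∀ z, z ≤ Pmin z := fun z => (hPmin z).2 fun y hy => hy.2
  have idM : ∀ z, Pmax (Pmax z) = Pmax z := fun z =>
    le_antisymm (leM _) ((hPmax z).2 fun y hy => (hPmax (Pmax z)).1 ⟨hy.1, (hPmax z).1 hy⟩)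
  have idm : ∀ z, Pmin (Pmin z) = Pmin z := fun z =>
    le_antisymm ((hPmin z).2 fun y hy => (hPmin (Pmin z)).1 ⟨hy.1, (hPmin z).1 hy⟩) (lem _)
  have fM : ∀ x ∈ E, Pmax x = x := fun x hx =>
    le_antisymm (leM x) ((hPmax x).1 ⟨subset_maxGen hx, le_rfl⟩)
  have fm : ∀ x ∈ E, Pmin x = x := fun x hx =>
    le_antisymm ((hPmin x).1 ⟨subset_minGen hx, le_rfl⟩) (lem x)
  have id1 : ∀ z, Pmin (Pmax (Pmin (Pmax z))) = Pmin (Pmax z) := fun z =>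
    le_antisymm ((sm.1 (leM _)).trans (idm _).le)
      (sm.1 ((idM z).symm.le.trans (sM.1 (lem _))))
  have id2 : ∀ z, Pmax (Pmin (Pmax (Pmin z))) = Pmax (Pmin z) := fun z =>
    le_antisymm (sM.1 ((sm.1 (leM _)).trans (idm z).le))
      ((idM _).symm.le.trans (sM.1 (lem _)))
  have inv1 : ∀ x ∈ Set.range (Pmin ∘ Pmax), (Pmin ∘ Pmax) ((Pmax ∘ Pmin) x) = x := by
    rintro _ ⟨x, rfl⟩
    simp only [Function.comp, idM, idm, id1]
  have inv2 : ∀ y ∈ Set.range (Pmax ∘ Pmin), (Pmax ∘ Pmin) ((Pmin ∘ Pmax) y) = y := by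
    rintro _ ⟨x, rfl⟩
    simp only [Function.comp, idM, idm, id2]
  refine ⟨range_of_idem E hE _ (sm.comp' sM) id1 (fun x hx => ?_),
    range_of_idem E hE _ (sM.comp' sm) id2 (fun x hx => ?_), ⟨?_, ?_, ?_⟩, inv1, inv2⟩
  · simp only [Function.comp, fM x hx, fm x hx]
  · simp only [Function.comp, fM x hx, fm x hx]
  · exact fun x _ => ⟨x, rfl⟩
  · intro x hx y hy hxy
    rw [← inv1 x hx, hxy, inv1 y hy]
  · exact fun y hy => ⟨(Pmin ∘ Pmax) y, ⟨y, rfl⟩, inv2 y hy⟩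

end Ambitropical
end

section
/- Let E be a nonempty subset of ℝ^n and let F be a closed ambitropical cone containing E. Then barQ^+_E ∘ barQ^-_F ∘ barQ^+_E = barQ^+_E and barQ^-_E ∘ barQ^+_F ∘ barQ^-_E = barQ^-_E, where barQ^-_X = P^min_X ∘ P^max_X and barQ^+_X = P^max_X ∘ P^min_X. -/
open Set Filter Topology

namespace Ambitropical

variable {n : ℕ}

theorem MaxGen_mono' {E F : Set (Fin n → ℝ)} (h : E ⊆ F) : MaxGen E ⊆ MaxGen F := by
  rintro x ⟨S, hS, r⟩
  exact ⟨S, hS.trans h, r⟩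

theorem MinGen_mono' {E F : Set (Fin n → ℝ)} (h : E ⊆ F) : MinGen E ⊆ MinGen F := by
  rintro x ⟨S, hS, r⟩
  exact ⟨S, hS.trans h, r⟩

/-- Lower projections onto nested sets: monotone, deflationary, absorbing. -/
theorem lower_facts {G H : Set (Fin n → ℝ)} (h : G ⊆ H) {A a : (Fin n → ℝ) → Fin n → ℝ}
    (hA : ∀ z, IsLUB {y | y ∈ G ∧ y ≤ z} (A z)) (ha : ∀ z, IsLUB {y | y ∈ H ∧ y ≤ z} (a z)) :
    Monotone A ∧ (∀ x, A x ≤ x) ∧ (∀ x, a (A x) = A x) ∧ (∀ x, A (a x) = A x) := by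
  have hm : Monotone A := fun x y hxy =>
    (hA x).2 fun w hw => (hA y).1 ⟨hw.1, hw.2.trans hxy⟩
  have hl : ∀ x, A x ≤ x := fun x => (hA x).2 fun w hw => hw.2
  have hal : ∀ x, a x ≤ x := fun x => (ha x).2 fun w hw => hw.2
  refine ⟨hm, hl, fun x => le_antisymm (hal _) ?_, fun x => le_antisymm (hm (hal x)) ?_⟩
  · exact (hA x).2 fun w hw => (ha (A x)).1 ⟨h hw.1, (hA x).1 hw⟩
  · exact (hA x).2 fun w hw => (hA (a x)).1 ⟨hw.1, (ha x).1 ⟨h hw.1, hw.2⟩⟩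

/-- Dual of `lower_facts`. -/
theorem upper_facts {G H : Set (Fin n → ℝ)} (h : G ⊆ H) {B b : (Fin n → ℝ) → Fin n → ℝ}
    (hB : ∀ z, IsGLB {y | y ∈ G ∧ z ≤ y} (B z)) (hb : ∀ z, IsGLB {y | y ∈ H ∧ z ≤ y} (b z)) :
    Monotone B ∧ (∀ x, x ≤ B x) ∧ (∀ x, b (B x) = B x) ∧ (∀ x, B (b x) = B x) := by
  have hm : Monotone B := fun x y hxy =>
    (hB y).2 fun w hw => (hB x).1 ⟨hw.1, hxy.trans hw.2⟩
  have hl : ∀ x, x ≤ B x := fun x => (hB x).2 fun w hw => hw.2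
  have hbl : ∀ x, x ≤ b x := fun x => (hb x).2 fun w hw => hw.2
  refine ⟨hm, hl, fun x => le_antisymm ?_ (hbl _), fun x => le_antisymm ?_ (hm (hbl x))⟩
  · exact (hB x).2 fun w hw => (hb (B x)).1 ⟨h hw.1, (hB x).1 hw⟩
  · exact (hB x).2 fun w hw => (hB (b x)).1 ⟨hw.1, (hb x).1 ⟨h hw.1, hw.2⟩⟩

/-- Let `E ⊆ ℝ^n` be nonempty and let `F` be a closed
ambitropical cone containing `E`. Then
`Q⁺_E ∘ Q⁻_F ∘ Q⁺_E = Q⁺_E` and `Q⁻_E ∘ Q⁺_F ∘ Q⁻_E = Q⁻_E`, where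
`Q⁻_X = P^min_X ∘ P^max_X` and `Q⁺_X = P^max_X ∘ P^min_X`. -/
theorem ambitropical_hull_injection_identities {n : ℕ}
    (E F : Set (Fin n → ℝ)) (hE : E.Nonempty) (hEF : E ⊆ F)
    (hF : IsAmbitropicalCone F) (hFcl : IsClosed F)
    (PmaxE PminE PmaxF PminF : (Fin n → ℝ) → Fin n → ℝ)
    (hPmaxE : IsPmaxMap E PmaxE) (hPminE : IsPminMap E PminE)
    (hPmaxF : IsPmaxMap F PmaxF) (hPminF : IsPminMap F PminF) :
    (PmaxE ∘ PminE) ∘ (PminF ∘ PmaxF) ∘ (PmaxE ∘ PminE) = PmaxE ∘ PminE ∧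
    (PminE ∘ PmaxE) ∘ (PmaxF ∘ PminF) ∘ (PminE ∘ PmaxE) = PminE ∘ PmaxE := by
  obtain ⟨mA, lA, aA, Aa⟩ := lower_facts (MaxGen_mono' hEF) hPmaxE hPmaxF
  obtain ⟨mB, lB, bB, Bb⟩ := upper_facts (MinGen_mono' hEF) hPminE hPminF
  obtain ⟨-, -, AA, -⟩ := lower_facts subset_rfl hPmaxE hPmaxE
  obtain ⟨-, -, BB, -⟩ := upper_facts subset_rfl hPminE hPminE
  constructor
  · funext x
    simp only [Function.comp_apply, aA, Bb]
    apply le_antisymm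
    · exact mA ((mB (lA _)).trans_eq (BB x))
    · exact (AA _).symm.le.trans (mA (lB _))
  · funext x
    simp only [Function.comp_apply, bB, Aa]
    apply le_antisymm
    · exact (mB (lA _)).trans_eq (BB _)
    · exact mB ((AA x).symm.le.trans (mA (lB _)))

end Ambitropical
end

section
/- Let E be an additive cone of ℝ^n. Then E is a closed ambitropical cone if and only if E is hyperconvex for the sup-norm metric: for every nonempty family of points (x_α)_{α∈Γ} in E and nonnegative radii (r_α)_{α∈Γ} such that ‖x_α − x_β‖_∞ ≤ r_α + r_β for all α, β ∈ Γ, the intersection ⋂_{α∈Γ} {y ∈ E : ‖y − x_α‖_∞ ≤ r_α} is nonempty. -/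
open Set Filter Topology

namespace Ambitropical

variable {n : ℕ}

/-- Hyperconvexity of `E` for the sup-norm metric. -/
def Hyp (E : Set (Fin n → ℝ)) : Prop :=
  ∀ (ι : Type) (x : ι → Fin n → ℝ) (r : ι → ℝ),
        (∀ a, x a ∈ E) → (∀ a, 0 ≤ r a) →
        (∀ a b, ‖x a - x b‖ ≤ r a + r b) →
        ∃ y ∈ E, ∀ a, ‖y - x a‖ ≤ r a

lemma coord_le (u v : Fin n → ℝ) (i : Fin n) : u i - v i ≤ ‖u - v‖ :=
  (le_abs_self _).trans (norm_le_pi_norm (u - v) i)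

/-- A hyperconvex additive cone has the interpolation property. -/
lemma between (E : Set (Fin n → ℝ)) (hE : AdditiveCone E) (h : Hyp E)
    (A B : Set (Fin n → ℝ)) (hA : A ⊆ E) (hB : B ⊆ E) (p q : Fin n → ℝ) (hp : p ∈ A) (hq : q ∈ B)
    (hAB : ∀ a ∈ A, ∀ b ∈ B, a ≤ b) :
    ∃ y ∈ E, (∀ a ∈ A, a ≤ y) ∧ ∀ b ∈ B, y ≤ b := by
  obtain ⟨y, hy, hb⟩ := h (A ⊕ B)
    (Sum.elim (fun a i => ‖q - a.1‖ + a.1 i) (fun b i => -‖b.1 - p‖ + b.1 i))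
    (Sum.elim (fun a => ‖q - a.1‖) (fun b => ‖b.1 - p‖))
    (by
      rintro (a | b)
      · exact hE _ (hA a.2) _
      · exact hE _ (hB b.2) _)
    (by rintro (a | b) <;> exact norm_nonneg _)
    (by
      rintro (⟨a, ha⟩ | ⟨b, hb⟩) (⟨a', ha'⟩ | ⟨b', hb'⟩) <;>
        refine (pi_norm_le_iff_of_nonneg (add_nonneg (norm_nonneg _) (norm_nonneg _))).2
          fun i => abs_le.2 ?_ <;> simp only [Sum.elim_inl, Sum.elim_inr, Pi.sub_apply]
      · have := coord_le q a i
        have := coord_le q a' i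
        have := hAB a ha q hq i
        have := hAB a' ha' q hq i
        constructor <;> linarith
      · have := coord_le q a i
        have := coord_le b' p i
        have := hAB a ha b' hb' i
        have := hAB p hp q hq i
        constructor <;> linarith
      · have := coord_le q a' i
        have := coord_le b p i
        have := hAB a' ha' b hb i
        have := hAB p hp q hq i
        constructor <;> linarith
      · have := coord_le b p i
        have := coord_le b' p i
        have := hAB p hp b hb i
        have := hAB p hp b' hb' i
        constructor <;> linarith)
  refine ⟨y, hy, fun a ha i => ?_, fun b hb' i => ?_⟩
  · have h1 := abs_le.1 ((norm_le_pi_norm _ i).trans (hb (Sum.inl ⟨a, ha⟩)))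
    simp only [Sum.elim_inl, Pi.sub_apply] at h1
    linarith [h1.1]
  · have h1 := abs_le.1 ((norm_le_pi_norm _ i).trans (hb (Sum.inr ⟨b, hb'⟩)))
    simp only [Sum.elim_inr, Pi.sub_apply] at h1
    linarith [h1.2]

lemma hyp_closed (E : Set (Fin n → ℝ)) (h : Hyp E) : IsClosed E := by
  refine isClosed_of_closure_subset fun z hz => ?_
  obtain ⟨y, hy, hb⟩ := h E (fun e => e.1) (fun e => ‖e.1 - z‖) (fun e => e.2)
    (fun e => norm_nonneg _) (fun a b => by
      have := norm_sub_le_norm_sub_add_norm_sub a.1 z b.1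
      rwa [norm_sub_rev z b.1] at this)
  have : y = z := by
    refine eq_of_forall_dist_le fun ε hε => ?_
    obtain ⟨e, he, hd⟩ := Metric.mem_closure_iff.1 hz (ε / 2) (half_pos hε)
    have h1 := hb ⟨e, he⟩
    simp only [← dist_eq_norm] at h1
    have h2 := dist_triangle y e z
    rw [dist_comm z e] at hd
    linarith
  exact this ▸ hy

lemma hyp_lattice (E : Set (Fin n → ℝ)) (hE : AdditiveCone E) (h : Hyp E)
    (x : Fin n → ℝ) (hx : x ∈ E) (y : Fin n → ℝ) (hy : y ∈ E) :
    (∃ z, IsLubWithin E {x, y} z) ∧ ∃ z, IsGlbWithin E {x, y} z := by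
  have hsub : ({x, y} : Set (Fin n → ℝ)) ⊆ E := by
    rintro _ (rfl | rfl) <;> assumption
  constructor
  · obtain ⟨z, hz, h1, h2⟩ := between E hE h {x, y} {w | w ∈ E ∧ ∀ v ∈ ({x, y} : Set _), v ≤ w}
      hsub (fun w hw => hw.1) x (fun i => ‖y - x‖ + x i) (by simp)
      ⟨hE _ hx _, by
        intro v hv i
        have h1 := coord_le y x i
        have h2 := norm_nonneg (y - x)
        rcases (hv : v = x ∨ v = y) with hv | hv <;> rw [hv] <;> show _ ≤ _ + _ <;> linarith⟩
      (fun a ha b hb => hb.2 a ha)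
    exact ⟨z, hz, h1, fun w hw hw' => h2 w ⟨hw, hw'⟩⟩
  · obtain ⟨z, hz, h1, h2⟩ := between E hE h {w | w ∈ E ∧ ∀ v ∈ ({x, y} : Set _), w ≤ v} {x, y}
      (fun w hw => hw.1) hsub (fun i => -‖x - y‖ + x i) x
      ⟨hE _ hx _, by
        intro v hv i
        have h1 := coord_le x y i
        have h2 := norm_nonneg (x - y)
        rcases (hv : v = x ∨ v = y) with hv | hv <;> rw [hv] <;> show _ + _ ≤ _ <;> linarith⟩ (by simp)
      (fun a ha b hb => ha.2 b hb)
    exact ⟨z, hz, h2, fun w hw hw' => h1 w ⟨hw, hw'⟩⟩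

lemma ambi_hyp (E : Set (Fin n → ℝ)) (hE : IsAmbitropicalCone E) (hc : IsClosed E) : Hyp E := by
  intro ι x r hx hr hd
  obtain ⟨hne, hadd, hlat⟩ := hE
  rcases isEmpty_or_nonempty ι with hι | ⟨⟨a0⟩⟩
  · obtain ⟨y, hy⟩ := hne
    exact ⟨y, hy, fun a => hι.elim a⟩
  have hlow : ∀ a b i, -r a + x a i ≤ r b + x b i := fun a b i => by
    have := coord_le (x a) (x b) i
    linarith [hd a b]
  have key : ∀ u : Finset ι, ∃ y ∈ E, (∀ a ∈ u, (fun i => -r a + x a i) ≤ y) ∧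
      (fun i => -r a0 + x a0 i) ≤ y ∧ ∀ b, y ≤ (fun i => r b + x b i) := by
    classical
    intro u
    induction u using Finset.induction_on with
    | empty => exact ⟨_, hadd _ (hx a0) (-r a0), by simp, le_rfl, fun b i => hlow a0 b i⟩
    | insert a u _ ih =>
      obtain ⟨y, hy, h1, h2, h3⟩ := ih
      obtain ⟨z, hz, hz1, hz2⟩ := (hlat y hy _ (hadd _ (hx a) (-r a))).1
      have hyz : y ≤ z := hz1 _ (by simp)
      refine ⟨z, hz, fun c hc => ?_, h2.trans hyz, fun b => hz2 _ (hadd _ (hx b) _) ?_⟩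
      · rcases Finset.mem_insert.1 hc with rfl | hc
        · exact hz1 _ (by simp)
        · exact (h1 c hc).trans hyz
      · rintro _ (rfl | rfl)
        · exact h3 b
        · exact fun i => hlow a b i
  have ball : ∀ (y : Fin n → ℝ) a, (fun i => -r a + x a i) ≤ y → y ≤ (fun i => r a + x a i) →
      y ∈ Metric.closedBall (x a) (r a) := fun y a h1 h2 => by
    rw [mem_closedBall_iff_norm, pi_norm_le_iff_of_nonneg (hr a)]
    intro i
    refine abs_le.2 ?_
    have h1 := h1 i
    have h2 := h2 i
    simp only [Pi.sub_apply] at *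
    constructor <;> linarith
  obtain ⟨y, hy, hy'⟩ := ((isCompact_closedBall (x a0) (r a0)).inter_right hc).inter_iInter_nonempty
    (fun a => Metric.closedBall (x a) (r a)) (fun a => Metric.isClosed_closedBall) (fun u => by
      obtain ⟨y, hy, h1, h2, h3⟩ := key u
      exact ⟨y, ⟨ball y a0 h2 (h3 a0), hy⟩, Set.mem_iInter₂.2 fun a ha =>
        ball y a (h1 a ha) (h3 a)⟩)
  exact ⟨y, hy.2, fun a => mem_closedBall_iff_norm.1 (Set.mem_iInter.1 hy' a)⟩

/-- An additive cone `E ⊆ ℝ^n` is a closed ambitropical cone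
iff it is hyperconvex for the sup-norm metric: every family of points of `E`
with nonnegative radii satisfying the pairwise condition
`‖x_α - x_β‖_∞ ≤ r_α + r_β` has a common point of `E` in all the balls. -/
theorem closed_ambitropical_iff_hyperconvex {n : ℕ}
    (E : Set (Fin n → ℝ)) (hE : AdditiveCone E) :
    (IsAmbitropicalCone E ∧ IsClosed E) ↔
      ∀ (ι : Type) (x : ι → Fin n → ℝ) (r : ι → ℝ),
        (∀ a, x a ∈ E) → (∀ a, 0 ≤ r a) →
        (∀ a b, ‖x a - x b‖ ≤ r a + r b) →
        ∃ y ∈ E, ∀ a, ‖y - x a‖ ≤ r a := by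
  constructor
  · rintro ⟨h, hc⟩
    exact ambi_hyp E h hc
  · intro h
    refine ⟨⟨?_, hE, hyp_lattice E hE h⟩, hyp_closed E h⟩
    obtain ⟨y, hy, -⟩ := h Empty (fun a => a.elim) (fun a => a.elim) (fun a => a.elim)
      (fun a => a.elim) (fun a => a.elim)
    exact ⟨y, hy⟩

end Ambitropical
end
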